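/- arXiv:math/0212138 — 3 statements merged into one kernel-verified Lean document; each statement's English description precedes it below -/
import Mathlib

section
/- Let n ≥ 2, let M be a Garside monoid with Garside element h, and let H be the group of fractions of M (so M is a submonoid of H and every element of H equals a⁻¹b for some a, b ∈ M); in particular h ≠ 1. Let ρ : Bₙ → Aut(G) be the Artin type representation associated to (H,h), where G = H₁ ∗ ⋯ ∗ Hₙ, let G̃ = G ⋊_ρ Bₙ, and let M̃ be the submonoid of G̃ generated by φ₁(M) together with the elements σ₁, …, σ_{n−1}. Then M̃ is a Garside monoid with Garside element Δ = (h₁ σ₁ σ₂ ⋯ σ_{n−1})ⁿ; explicitly: M̃ is finitely generated and atomic; M̃ is left and right cancellative; the partially ordered sets (M̃, ≤_L) and (M̃, ≤_R) given by left and right divisibility are lattices; the set L(Δ) = {x ∈ M̃ : x ≤_L Δ} generates M̃; and L(Δ) = R(Δ) where R(Δ) = {x ∈ M̃ : x ≤_R Δ}. -/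
def braidRels (m : ℕ) : Set (FreeGroup (Fin m)) :=
  { r | (∃ i j : Fin m, (i : ℕ) + 1 = (j : ℕ) ∧
          r = FreeGroup.of i * FreeGroup.of j * FreeGroup.of i *
              (FreeGroup.of j * FreeGroup.of i * FreeGroup.of j)⁻¹) ∨
        (∃ i j : Fin m, (i : ℕ) + 2 ≤ (j : ℕ) ∧
          r = FreeGroup.of i * FreeGroup.of j * (FreeGroup.of j * FreeGroup.of i)⁻¹) }

abbrev BraidGroup (m : ℕ) : Type := PresentedGroup (braidRels m)

def braidGen {m : ℕ} (i : Fin m) : BraidGroup m := PresentedGroup.of i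

def idx0 {n : ℕ} (k : Fin (n - 1)) : Fin n := ⟨k.1, by have := k.2; omega⟩
def idx1 {n : ℕ} (k : Fin (n - 1)) : Fin n := ⟨k.1 + 1, by have := k.2; omega⟩

def IsArtinRep {n : ℕ} {H : Type} [Group H] (h : H)
    (ρ : BraidGroup (n - 1) →* MulAut (Monoid.CoprodI (fun _ : Fin n => H))) : Prop :=
  ∀ k : Fin (n - 1),
    (∀ y : H, ρ (braidGen k) (Monoid.CoprodI.of (i := idx0 k) y) =
        (Monoid.CoprodI.of (i := idx0 k) h)⁻¹ * Monoid.CoprodI.of (i := idx1 k) y *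
          Monoid.CoprodI.of (i := idx0 k) h) ∧
    (∀ y : H, ρ (braidGen k) (Monoid.CoprodI.of (i := idx1 k) y) =
        Monoid.CoprodI.of (i := idx0 k) h * Monoid.CoprodI.of (i := idx0 k) y *
          (Monoid.CoprodI.of (i := idx0 k) h)⁻¹) ∧
    (∀ j : Fin n, j ≠ idx0 k → j ≠ idx1 k →
      ∀ y : H, ρ (braidGen k) (Monoid.CoprodI.of (i := j) y) = Monoid.CoprodI.of (i := j) y)

/-- Left divisibility in a monoid: `a ≤_L b`. -/
def leftDvd {M : Type*} [Monoid M] (a b : M) : Prop := ∃ c, a * c = b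

/-- Right divisibility in a monoid: `a ≤_R b`. -/
def rightDvd {M : Type*} [Monoid M] (a b : M) : Prop := ∃ c, c * a = b

/-- A monoid is atomic if it admits a norm `ν : M → ℕ`. -/
def IsAtomicMonoid (M : Type*) [Monoid M] : Prop :=
  ∃ ν : M → ℕ, (∀ a, ν a = 0 ↔ a = 1) ∧ ∀ a b, ν a + ν b ≤ ν (a * b)

/-- `M` is a Garside monoid with Garside element `Δ`: finitely generated, atomic,
left and right cancellative, the left and right divisibility orders are lattices
(partial orders with binary joins and meets), the left divisors of `Δ` generate `M`,
and the left and right divisors of `Δ` coincide. -/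
def IsGarside (M : Type*) [Monoid M] (Δ : M) : Prop :=
  (∃ T : Finset M, Submonoid.closure (T : Set M) = ⊤) ∧
  IsAtomicMonoid M ∧
  (∀ a b c : M, a * b = a * c → b = c) ∧
  (∀ a b c : M, b * a = c * a → b = c) ∧
  (∀ a b : M, leftDvd a b → leftDvd b a → a = b) ∧
  (∀ a b : M, rightDvd a b → rightDvd b a → a = b) ∧
  (∀ a b : M, ∃ j, leftDvd a j ∧ leftDvd b j ∧ ∀ z, leftDvd a z → leftDvd b z → leftDvd j z) ∧
  (∀ a b : M, ∃ m, leftDvd m a ∧ leftDvd m b ∧ ∀ z, leftDvd z a → leftDvd z b → leftDvd z m) ∧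
  (∀ a b : M, ∃ j, rightDvd a j ∧ rightDvd b j ∧ ∀ z, rightDvd a z → rightDvd b z → rightDvd j z) ∧
  (∀ a b : M, ∃ m, rightDvd m a ∧ rightDvd m b ∧ ∀ z, rightDvd z a → rightDvd z b → rightDvd z m) ∧
  Submonoid.closure {x : M | leftDvd x Δ} = ⊤ ∧
  {x : M | leftDvd x Δ} = {x : M | rightDvd x Δ}

/-- The submonoid `M̃` of `G̃ = G ⋊_ρ Bₙ` generated by `φ₁(M)` and the positive braids. -/
def tildeM (n : ℕ) (hn : 2 ≤ n) {H : Type} [Group H] (M : Submonoid H)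
    (ρ : BraidGroup (n - 1) →* MulAut (Monoid.CoprodI (fun _ : Fin n => H))) :
    Submonoid (Monoid.CoprodI (fun _ : Fin n => H) ⋊[ρ] BraidGroup (n - 1)) :=
  Submonoid.closure
    (Set.range (fun m : M =>
        SemidirectProduct.inl (Monoid.CoprodI.of (i := (⟨0, by omega⟩ : Fin n)) (m : H))) ∪
     Set.range (fun i : Fin (n - 1) => SemidirectProduct.inr (braidGen i)))

/-- The element `Δ = (h₁ σ₁ σ₂ ⋯ σ_{n-1})ⁿ` of `G̃ = G ⋊_ρ Bₙ`. -/
def tildeDelta (n : ℕ) (hn : 2 ≤ n) {H : Type} [Group H] (h : H)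
    (ρ : BraidGroup (n - 1) →* MulAut (Monoid.CoprodI (fun _ : Fin n => H))) :
    Monoid.CoprodI (fun _ : Fin n => H) ⋊[ρ] BraidGroup (n - 1) :=
  (SemidirectProduct.inl (Monoid.CoprodI.of (i := (⟨0, by omega⟩ : Fin n)) h) *
    (List.ofFn (fun i : Fin (n - 1) =>
      (SemidirectProduct.inr (braidGen i) :
        Monoid.CoprodI (fun _ : Fin n => H) ⋊[ρ] BraidGroup (n - 1)))).prod) ^ n

/-! ### Complemented presentations -/

namespace Complemented

variable {S : Type*} (c : S → S → FreeMonoid S)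

/-- The relations `s · (s \ t) = t · (t \ s)` attached to a complement `c s t = s \ t`. -/
def rels (u v : FreeMonoid S) : Prop :=
  ∃ s t, u = FreeMonoid.of s * c s t ∧ v = FreeMonoid.of t * c t s

/-- The monoid presented by a complement. -/
abbrev Mon : Type _ := PresentedMonoid (rels c)

/-- The projection from words to the monoid presented by a complement. -/
abbrev word : FreeMonoid S →* Mon c := PresentedMonoid.mk (rels c)

/-- The generators of the monoid presented by a complement. -/
abbrev gen (s : S) : Mon c := word c (FreeMonoid.of s)

theorem gen_mul_word (s t : S) : gen c s * word c (c s t) = gen c t * word c (c t s) := by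
  rw [← map_mul, ← map_mul]
  exact PresentedMonoid.mk_eq_mk_of_rel ⟨s, t, rfl, rfl⟩

theorem eq_one_or_gen_mul (x : Mon c) : x = 1 ∨ ∃ s y, x = gen c s * y := by
  obtain ⟨a, rfl⟩ := PresentedMonoid.surjective_mk x
  cases a using FreeMonoid.casesOn with
  | one => exact Or.inl (map_one _)
  | of_mul s w => exact Or.inr ⟨s, word c w, map_mul _ _ _⟩

/-- The generator `s` and the generator `t` satisfy the divisibility property of the complement on
all elements of `G`. -/
def Reduces (G : Mon c → Prop) : Prop :=
  ∀ s t X Y, G (gen c s * X) → gen c s * X = gen c t * Y →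
    ∃ U, X = word c (c s t) * U ∧ Y = word c (c t s) * U

/-- The cube condition at `(s, r, t)`, restricted to the elements of `G`. -/
def Cube (G : Mon c → Prop) (s r t : S) : Prop :=
  ∀ Z Z', G (word c (c r s) * Z) → word c (c r s) * Z = word c (c r t) * Z' →
    ∃ U, word c (c s r) * Z = word c (c s t) * U ∧ word c (c t r) * Z' = word c (c t s) * U

variable {c}

theorem Cube.symm {G : Mon c → Prop} {s r t : S} (h : Cube c G s r t) : Cube c G t r s := by
  intro Z Z' hG he
  obtain ⟨U, h1, h2⟩ := h Z' Z (he ▸ hG) he.symm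
  exact ⟨U, h2, h1⟩

/-- The first letters of two equivalent words are related by the complement. -/
def HeadRel (c : S → S → FreeMonoid S) (u v : FreeMonoid S) : Prop :=
  (u = 1 ∧ v = 1) ∨ ∃ s x t y, u = FreeMonoid.of s * x ∧ v = FreeMonoid.of t * y ∧
    ∃ U, word c x = word c (c s t) * U ∧ word c y = word c (c t s) * U

theorem of_mul_inj {s t : S} {x y : FreeMonoid S}
    (h : FreeMonoid.of s * x = FreeMonoid.of t * y) : s = t ∧ x = y :=
  List.cons.inj h

theorem of_mul_ne_one {s : S} {x : FreeMonoid S} : FreeMonoid.of s * x ≠ 1 :=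
  List.cons_ne_nil s x

/-- In a noetherian monoid presented by a complement satisfying the cube condition, the relation
`s · (s \ t) = t · (t \ s)` computes the least common multiple of `s` and `t`. -/
theorem reduces_of_cube (ν : Mon c → ℕ) (hν : ∀ a b, ν a + ν b ≤ ν (a * b))
    (hs : ∀ s, 0 < ν (gen c s)) (hc : ∀ s, c s s = 1)
    (cube : ∀ G : Mon c → Prop, (∀ A B, G (A * B) → G B) → Reduces c G →
      ∀ s r t, Cube c G s r t) :
    Reduces c (fun _ => True) := by
  have main : ∀ n, Reduces c (fun x => ν x ≤ n) := by
    intro n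
    induction n using Nat.strong_induction_on with | _ n ih
    have key : ∀ u v, ConGen.Rel (rels c) u v → ν (word c u) ≤ n → HeadRel c u v := by
      intro u v huv
      induction huv with
      | of x y h =>
        intro _
        obtain ⟨s, t, rfl, rfl⟩ := h
        exact Or.inr ⟨s, _, t, _, rfl, rfl, 1, by simp, by simp⟩
      | refl x =>
        intro _
        cases x using FreeMonoid.casesOn with
        | one => exact Or.inl ⟨rfl, rfl⟩
        | of_mul s w => exact Or.inr ⟨s, w, s, w, rfl, rfl, word c w, by simp [hc], by simp [hc]⟩
      | @symm x y hxy ihxy =>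
        intro hn
        have e : word c x = word c y := PresentedMonoid.mk_eq_mk_iff.2 hxy
        rcases ihxy (e ▸ hn) with ⟨rfl, rfl⟩ | ⟨s, x, t, y, rfl, rfl, U, h1, h2⟩
        · exact Or.inl ⟨rfl, rfl⟩
        · exact Or.inr ⟨t, y, s, x, rfl, rfl, U, h2, h1⟩
      | @trans x y z hxy hyz ih1 ih2 =>
        intro hn
        have e : word c x = word c y := PresentedMonoid.mk_eq_mk_iff.2 hxy
        have hn' : ν (word c y) ≤ n := e ▸ hn
        rcases ih1 hn with ⟨rfl, rfl⟩ | ⟨s, x, r, y, rfl, rfl, Z, h1, h2⟩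
        · exact ih2 hn'
        · rcases ih2 hn' with ⟨h, -⟩ | ⟨r', y', t, z, hy, rfl, Z', h3, h4⟩
          · exact absurd h of_mul_ne_one
          · obtain ⟨rfl, rfl⟩ := of_mul_inj hy
            have hlt : ν (word c y) < n := by
              have h1 := hν (gen c r) (word c y)
              rw [← map_mul] at h1
              have h2 := hs r
              omega
            obtain ⟨U, h5, h6⟩ := cube (fun x => ν x ≤ ν (word c y))
              (fun A B h => by have := hν A B; omega) (ih _ hlt) s r t Z Z' (h2 ▸ le_rfl) (h2 ▸ h3)
            exact Or.inr ⟨s, x, t, z, rfl, rfl, U, h1.trans h5, h4.trans h6⟩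
      | @mul w x y z hwx hyz ih1 ih2 =>
        intro hn
        have e : word c w = word c x := PresentedMonoid.mk_eq_mk_iff.2 hwx
        have e' : word c y = word c z := PresentedMonoid.mk_eq_mk_iff.2 hyz
        have hw : ν (word c w) ≤ n := by
          have := hν (word c w) (word c y)
          rw [← map_mul] at this
          omega
        rcases ih1 hw with ⟨rfl, rfl⟩ | ⟨s, x, t, x', rfl, rfl, U, h1, h2⟩
        · simpa using ih2 (by simpa using hn)
        · exact Or.inr ⟨s, x * y, t, x' * z, mul_assoc _ _ _, mul_assoc _ _ _, U * word c y,
            by rw [map_mul, h1, mul_assoc], by rw [map_mul, h2, mul_assoc, e']⟩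
    intro s t X Y hn he
    obtain ⟨x, rfl⟩ := PresentedMonoid.surjective_mk X
    obtain ⟨y, rfl⟩ := PresentedMonoid.surjective_mk Y
    rw [← map_mul, ← map_mul] at he
    rcases key _ _ (PresentedMonoid.mk_eq_mk_iff.1 he) (by simpa using hn) with
      ⟨h, -⟩ | ⟨s', x', t', y', h1, h2, U, h3, h4⟩
    · exact absurd h of_mul_ne_one
    · obtain ⟨rfl, rfl⟩ := of_mul_inj h1
      obtain ⟨rfl, rfl⟩ := of_mul_inj h2
      exact ⟨U, h3, h4⟩
  intro s t X Y _ he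
  exact main _ s t X Y le_rfl he

theorem mul_left_cancel_of_reduces (hr : Reduces c (fun _ => True)) (a x y : Mon c)
    (h : a * x = a * y) : x = y := by
  obtain ⟨w, rfl⟩ := PresentedMonoid.surjective_mk a
  induction w generalizing x y with
  | one => simpa using h
  | of s =>
    obtain ⟨U, h1, h2⟩ := hr s s x y trivial h
    rw [h1, h2]
  | mul u v hu hv =>
    rw [map_mul, mul_assoc, mul_assoc] at h
    exact hv _ _ (hu _ _ h)

theorem exists_lcm_of_reduces (ν : Mon c → ℕ) (hν : ∀ a b, ν a + ν b ≤ ν (a * b))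
    (hs : ∀ s, 0 < ν (gen c s)) (hr : Reduces c (fun _ => True)) (a b w : Mon c)
    (ha : leftDvd a w) (hb : leftDvd b w) :
    ∃ j, leftDvd a j ∧ leftDvd b j ∧ ∀ z, leftDvd a z → leftDvd b z → leftDvd j z := by
  have canc := mul_left_cancel_of_reduces hr
  induction hn : ν w using Nat.strong_induction_on generalizing a b w with | _ n ih
  subst hn
  rcases eq_one_or_gen_mul c a with rfl | ⟨s, a, rfl⟩
  · exact ⟨b, ⟨b, one_mul b⟩, ⟨1, mul_one b⟩, fun z _ h => h⟩
  rcases eq_one_or_gen_mul c b with rfl | ⟨t, b, rfl⟩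
  · exact ⟨gen c s * a, ⟨1, mul_one _⟩, ⟨_, one_mul _⟩, fun z h _ => h⟩
  obtain ⟨a', rfl⟩ := ha
  obtain ⟨b', hb⟩ := hb
  rw [mul_assoc, mul_assoc] at hb
  obtain ⟨U, h1, h2⟩ := hr s t _ _ trivial hb.symm
  have hlt : ν (a * a') < ν (gen c s * a * a') := by
    rw [mul_assoc]
    have := hν (gen c s) (a * a')
    have := hs s
    omega
  have hlt' : ν (b * b') < ν (gen c s * a * a') := by
    rw [mul_assoc, ← hb]
    have := hν (gen c t) (b * b')
    have := hs t
    omega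
  have hlt'' : ν U < ν (gen c s * a * a') := by
    have := hν (word c (c s t)) U
    rw [h1] at hlt
    omega
  obtain ⟨A, ⟨A1, hA1⟩, ⟨A2, hA2⟩, hA⟩ :=
    ih _ hlt a (word c (c s t)) (a * a') ⟨_, rfl⟩ ⟨U, h1.symm⟩ rfl
  obtain ⟨B, ⟨B1, hB1⟩, ⟨B2, hB2⟩, hB⟩ :=
    ih _ hlt' b (word c (c t s)) (b * b') ⟨_, rfl⟩ ⟨U, h2.symm⟩ rfl
  obtain ⟨A3, hA3⟩ := hA (a * a') ⟨_, rfl⟩ ⟨U, h1.symm⟩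
  obtain ⟨B3, hB3⟩ := hB (b * b') ⟨_, rfl⟩ ⟨U, h2.symm⟩
  have e1 : A2 * A3 = U := canc (word c (c s t)) _ _ (by rw [← mul_assoc, hA2, hA3, h1])
  have e2 : B2 * B3 = U := canc (word c (c t s)) _ _ (by rw [← mul_assoc, hB2, hB3, h2])
  obtain ⟨K, ⟨K1, hK1⟩, ⟨K2, hK2⟩, hK⟩ := ih _ hlt'' A2 B2 U ⟨_, e1⟩ ⟨_, e2⟩ rfl
  have hst := gen_mul_word c s t
  refine ⟨gen c s * word c (c s t) * K, ⟨A1 * K1, ?_⟩, ⟨B1 * K2, ?_⟩, ?_⟩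
  · rw [← hK1, mul_assoc, ← mul_assoc a, hA1, ← hA2]
    simp only [mul_assoc]
  · rw [hst, ← hK2, mul_assoc, ← mul_assoc b, hB1, ← hB2]
    simp only [mul_assoc]
  · rintro z ⟨x, rfl⟩ ⟨y, hy⟩
    rw [mul_assoc, mul_assoc] at hy
    obtain ⟨V, h3, h4⟩ := hr s t _ _ trivial hy.symm
    obtain ⟨C, hC⟩ := hA (a * x) ⟨_, rfl⟩ ⟨V, h3.symm⟩
    obtain ⟨D, hD⟩ := hB (b * y) ⟨_, rfl⟩ ⟨V, h4.symm⟩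
    obtain ⟨E, hE⟩ := hK V
      ⟨C, canc (word c (c s t)) _ _ (by rw [← mul_assoc, hA2, hC, h3])⟩
      ⟨D, canc (word c (c t s)) _ _ (by rw [← mul_assoc, hB2, hD, h4])⟩
    exact ⟨E, by rw [mul_assoc, hE, mul_assoc, ← h3, mul_assoc]⟩

end Complemented

/-! ### Garside monoids from left divisibility -/

section LeftToRight

variable {N : Type*} [Monoid N] {Δ : N} {Φ : N ≃* N}

theorem mul_pow_eq_pow_mul_iterate (hΦ : ∀ x, x * Δ = Δ * Φ x) (k : ℕ) (x : N) :
    x * Δ ^ k = Δ ^ k * Φ^[k] x := by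
  induction k generalizing x with
  | zero => simp
  | succ k ih => rw [pow_succ', ← mul_assoc, hΦ, mul_assoc, ih, Function.iterate_succ_apply,
      mul_assoc]

theorem exists_leftDvd_pow (hΦ : ∀ x, x * Δ = Δ * Φ x)
    (hgen : Submonoid.closure {x : N | leftDvd x Δ} = ⊤) (x : N) :
    ∃ k, leftDvd x (Δ ^ k) := by
  have hx : x ∈ Submonoid.closure {x : N | leftDvd x Δ} := hgen ▸ Submonoid.mem_top x
  induction hx using Submonoid.closure_induction with
  | mem x hx => exact ⟨1, by simpa using hx⟩
  | one => exact ⟨0, 1, by simp⟩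
  | mul x y _ _ hx hy =>
    obtain ⟨k, c, hc⟩ := hx
    obtain ⟨l, d, hd⟩ := hy
    refine ⟨k + l, d * Φ^[l] c, ?_⟩
    rw [← mul_assoc, mul_assoc x, hd, mul_assoc, ← mul_pow_eq_pow_mul_iterate hΦ, ← mul_assoc, hc,
      pow_add]

theorem mul_right_cancel_of_quasicentral (hΦ : ∀ x, x * Δ = Δ * Φ x)
    (hgen : Submonoid.closure {x : N | leftDvd x Δ} = ⊤)
    (hl : ∀ a b c : N, a * b = a * c → b = c) (a b c : N) (h : b * a = c * a) : b = c := by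
  obtain ⟨k, d, hd⟩ := exists_leftDvd_pow hΦ hgen a
  refine (Φ.injective.iterate k) (hl (Δ ^ k) _ _ ?_)
  rw [← mul_pow_eq_pow_mul_iterate hΦ, ← mul_pow_eq_pow_mul_iterate hΦ, ← hd, ← mul_assoc,
    ← mul_assoc, h]

theorem leftDvd_antisymm_of_norm {ν : N → ℕ} (h0 : ∀ a, ν a = 0 ↔ a = 1)
    (hν : ∀ a b, ν a + ν b ≤ ν (a * b)) (a b : N) (hab : leftDvd a b) (hba : leftDvd b a) :
    a = b := by
  obtain ⟨c, rfl⟩ := hab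
  obtain ⟨d, hd⟩ := hba
  have h1 := hν (a * c) d
  have h2 := hν a c
  rw [hd] at h1
  rw [(h0 c).1 (by omega), mul_one]

theorem rightDvd_antisymm_of_norm {ν : N → ℕ} (h0 : ∀ a, ν a = 0 ↔ a = 1)
    (hν : ∀ a b, ν a + ν b ≤ ν (a * b)) (a b : N) (hab : rightDvd a b) (hba : rightDvd b a) :
    a = b := by
  obtain ⟨c, rfl⟩ := hab
  obtain ⟨d, hd⟩ := hba
  have h1 := hν d (c * a)
  have h2 := hν c a
  rw [hd] at h1
  rw [(h0 c).1 (by omega), one_mul]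

theorem leftDvd_pow_of_le {x : N} {k l : ℕ} (hkl : k ≤ l) (h : leftDvd x (Δ ^ k)) :
    leftDvd x (Δ ^ l) := by
  obtain ⟨c, hc⟩ := h
  exact ⟨c * Δ ^ (l - k), by rw [← mul_assoc, hc, ← pow_add, Nat.add_sub_cancel' hkl]⟩

/-- A left cancellative noetherian monoid with conditional right lcms and a quasi-central element
whose left divisors generate is a Garside monoid. -/
theorem isGarside_of_left (hfg : ∃ T : Finset N, Submonoid.closure (T : Set N) = ⊤)
    (hatom : IsAtomicMonoid N) (hl : ∀ a b c : N, a * b = a * c → b = c)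
    (hlcm : ∀ a b w : N, leftDvd a w → leftDvd b w →
      ∃ j, leftDvd a j ∧ leftDvd b j ∧ ∀ z, leftDvd a z → leftDvd b z → leftDvd j z)
    (hΦ : ∀ x, x * Δ = Δ * Φ x)
    (hgen : Submonoid.closure {x : N | leftDvd x Δ} = ⊤) : IsGarside N Δ := by
  have hr := mul_right_cancel_of_quasicentral hΦ hgen hl
  have hdiv : {x : N | leftDvd x Δ} = {x : N | rightDvd x Δ} := by
    ext x
    constructor
    · rintro ⟨c, hc⟩
      refine ⟨Φ.symm c, hr c _ _ ?_⟩
      rw [mul_assoc, hc, hΦ, Φ.apply_symm_apply]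
    · rintro ⟨c, hc⟩
      refine ⟨Φ c, hl c _ _ ?_⟩
      rw [← mul_assoc, hc, hΦ]
  have hpow := exists_leftDvd_pow hΦ hgen
  have hpow2 : ∀ a b : N, ∃ k, leftDvd a (Δ ^ k) ∧ leftDvd b (Δ ^ k) := fun a b => by
    obtain ⟨k, hk⟩ := hpow a
    obtain ⟨l, hl⟩ := hpow b
    exact ⟨max k l, leftDvd_pow_of_le (le_max_left k l) hk,
      leftDvd_pow_of_le (le_max_right k l) hl⟩
  have hdivk : ∀ (k : ℕ) (x : N), leftDvd x (Δ ^ k) → rightDvd x (Δ ^ k) := by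
    rintro k x ⟨c, hc⟩
    refine ⟨Φ.symm^[k] c, hr c _ _ ?_⟩
    rw [mul_assoc, hc, mul_pow_eq_pow_mul_iterate hΦ,
      (Function.LeftInverse.iterate Φ.apply_symm_apply k) c]
  have hjoin : ∀ a b : N,
      ∃ j, leftDvd a j ∧ leftDvd b j ∧ ∀ z, leftDvd a z → leftDvd b z → leftDvd j z :=
    fun a b => by
      obtain ⟨k, h1, h2⟩ := hpow2 a b
      exact hlcm a b _ h1 h2
  have hmeetR : ∀ a b : N,
      ∃ m, rightDvd m a ∧ rightDvd m b ∧ ∀ z, rightDvd z a → rightDvd z b → rightDvd z m := by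
    intro a b
    obtain ⟨k, ha, hb⟩ := hpow2 a b
    obtain ⟨x, hx⟩ := hdivk k a ha
    obtain ⟨y, hy⟩ := hdivk k b hb
    obtain ⟨d, ⟨x', hx'⟩, ⟨y', hy'⟩, hd⟩ := hjoin x y
    obtain ⟨m, hm⟩ := hd (Δ ^ k) ⟨a, hx⟩ ⟨b, hy⟩
    refine ⟨m, ⟨x', hl x _ _ (by rw [← mul_assoc, hx', hm, hx])⟩,
      ⟨y', hl y _ _ (by rw [← mul_assoc, hy', hm, hy])⟩, ?_⟩
    rintro z ⟨p, rfl⟩ ⟨q, rfl⟩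
    have e : x * p = y * q := hr z _ _ (by rw [mul_assoc, hx, mul_assoc, hy])
    obtain ⟨f, hf⟩ := hd (x * p) ⟨p, rfl⟩ ⟨q, e.symm⟩
    exact ⟨f, hl d _ _ (by rw [← mul_assoc, hf, mul_assoc, hx, hm])⟩
  obtain ⟨ν, h0, hν⟩ := id hatom
  have hmeetL : ∀ a b : N,
      ∃ m, leftDvd m a ∧ leftDvd m b ∧ ∀ z, leftDvd z a → leftDvd z b → leftDvd z m := by
    classical
    intro a b
    let P : ℕ → Prop := fun n => ∃ m, leftDvd m a ∧ leftDvd m b ∧ ν m = n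
    have hP : P (Nat.findGreatest P (ν a)) := by
      refine Nat.findGreatest_spec (P := P) (Nat.zero_le (ν a)) ?_
      exact ⟨1, ⟨a, one_mul a⟩, ⟨b, one_mul b⟩, (h0 1).2 rfl⟩
    obtain ⟨m, hma, hmb, hm⟩ := hP
    refine ⟨m, hma, hmb, fun z hza hzb => ?_⟩
    obtain ⟨j, ⟨c, hc⟩, hzj, hj⟩ := hjoin m z
    obtain ⟨d, hd⟩ := hj a hma hza
    have h1 : ν j ≤ ν a := by
      have := hν j d
      rw [hd] at this
      omega
    have h2 : ν j ≤ ν m :=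
      hm ▸ Nat.le_findGreatest h1 ⟨j, hj a hma hza, hj b hmb hzb, rfl⟩
    have h3 := hν m c
    rw [hc] at h3
    rw [(h0 c).1 (by omega), mul_one] at hc
    exact hc ▸ hzj
  have hjoinR : ∀ a b : N,
      ∃ j, rightDvd a j ∧ rightDvd b j ∧ ∀ z, rightDvd a z → rightDvd b z → rightDvd j z := by
    classical
    intro a b
    let P : ℕ → Prop := fun n => ∃ j, rightDvd a j ∧ rightDvd b j ∧ ν j = n
    have hex : ∃ n, P n := by
      obtain ⟨k, ha, hb⟩ := hpow2 a b
      exact ⟨_, Δ ^ k, hdivk k a ha, hdivk k b hb, rfl⟩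
    obtain ⟨j, haj, hbj, hj⟩ := Nat.find_spec hex
    refine ⟨j, haj, hbj, fun z haz hbz => ?_⟩
    obtain ⟨m, ⟨c, hc⟩, hmz, hm⟩ := hmeetR j z
    have h1 : ν j ≤ ν m := hj ▸ Nat.find_min' hex ⟨m, hm a haj haz, hm b hbj hbz, rfl⟩
    have h3 := hν c m
    rw [hc] at h3
    rw [(h0 c).1 (by omega), one_mul] at hc
    exact hc ▸ hmz
  exact ⟨hfg, hatom, hl, hr, leftDvd_antisymm_of_norm h0 hν, rightDvd_antisymm_of_norm h0 hν,
    hjoin, hmeetL, hjoinR, hmeetR, hgen, hdiv⟩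

end LeftToRight

section Transport

variable {N N' : Type*} [Monoid N] [Monoid N']

theorem leftDvd_map_iff (e : N ≃* N') {a b : N} : leftDvd (e a) (e b) ↔ leftDvd a b := by
  constructor
  · rintro ⟨c, hc⟩
    exact ⟨e.symm c, e.injective (by rw [map_mul, e.apply_symm_apply, hc])⟩
  · rintro ⟨c, rfl⟩
    exact ⟨e c, (map_mul e a c).symm⟩

theorem rightDvd_map_iff (e : N ≃* N') {a b : N} : rightDvd (e a) (e b) ↔ rightDvd a b := by
  constructor
  · rintro ⟨c, hc⟩
    exact ⟨e.symm c, e.injective (by rw [map_mul, e.apply_symm_apply, hc])⟩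
  · rintro ⟨c, rfl⟩
    exact ⟨e c, (map_mul e c a).symm⟩

/-- Being a Garside monoid is invariant under isomorphism. -/
theorem IsGarside.map {Δ : N} (h : IsGarside N Δ) (e : N ≃* N') : IsGarside N' (e Δ) := by
  obtain ⟨⟨T, hT⟩, ⟨ν, h0, hν⟩, hl, hr, hal, har, hjl, hml, hjr, hmr, hg, hd⟩ := h
  refine ⟨?_, ⟨fun x => ν (e.symm x), fun a => by simp [h0], fun a b => by simp [hν]⟩,
    ?_, ?_, ?_, ?_, ?_, ?_, ?_, ?_, ?_, ?_⟩
  · classical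
    refine ⟨T.image e, ?_⟩
    rw [Finset.coe_image, ← MonoidHom.coe_coe e, ← MonoidHom.map_mclosure, hT,
      ← MonoidHom.mrange_eq_map]
    exact MonoidHom.mrange_eq_top.2 e.surjective
  · intro a b c h
    exact e.symm.injective (hl (e.symm a) _ _ (by simpa using congrArg e.symm h))
  · intro a b c h
    exact e.symm.injective (hr (e.symm a) _ _ (by simpa using congrArg e.symm h))
  all_goals try simp only [e.surjective.forall, e.surjective.exists, leftDvd_map_iff,
    rightDvd_map_iff, EmbeddingLike.apply_eq_iff_eq]
  · exact hal
  · exact har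
  · exact hjl
  · exact hml
  · exact hjr
  · exact hmr
  · have : {x : N' | leftDvd x (e Δ)} = e '' {x : N | leftDvd x Δ} := by
      ext x
      obtain ⟨x, rfl⟩ := e.surjective x
      simp [leftDvd_map_iff]
    rw [this, ← MonoidHom.coe_coe e, ← MonoidHom.map_mclosure, hg,
      ← MonoidHom.mrange_eq_map]
    exact MonoidHom.mrange_eq_top.2 e.surjective
  · ext x
    obtain ⟨x, rfl⟩ := e.surjective x
    simpa only [Set.mem_ofPred_eq, leftDvd_map_iff, rightDvd_map_iff] using Set.ext_iff.1 hd x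

end Transport

/-! ### Cubes of commuting and braided letters -/

namespace Complemented

variable {S : Type*} {c : S → S → FreeMonoid S} {G : Mon c → Prop} {s t r : S}

variable (c) in
/-- The complement makes `s` and `t` commute. -/
def Comm (s t : S) : Prop := c s t = FreeMonoid.of t ∧ c t s = FreeMonoid.of s

variable (c) in
/-- The complement makes `s` and `t` satisfy the braid relation. -/
def Braided (s t : S) : Prop :=
  c s t = FreeMonoid.of t * FreeMonoid.of s ∧ c t s = FreeMonoid.of s * FreeMonoid.of t

theorem Comm.symm (h : Comm c s t) : Comm c t s := ⟨h.2, h.1⟩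

theorem Braided.symm (h : Braided c s t) : Braided c t s := ⟨h.2, h.1⟩

theorem Comm.gen_mul (h : Comm c s t) (x : Mon c) :
    gen c s * (gen c t * x) = gen c t * (gen c s * x) := by
  have := gen_mul_word c s t
  rw [h.1, h.2] at this
  rw [← mul_assoc, this, mul_assoc]

theorem Braided.gen_mul (h : Braided c s t) (x : Mon c) :
    gen c s * (gen c t * (gen c s * x)) = gen c t * (gen c s * (gen c t * x)) := by
  have := gen_mul_word c s t
  rw [h.1, h.2, map_mul, map_mul] at this
  simp only [← mul_assoc] at this ⊢
  rw [this]

theorem Reduces.comm (hr : Reduces c G) (h : Comm c s t) {X Y : Mon c} (hG : G (gen c s * X))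
    (he : gen c s * X = gen c t * Y) : ∃ U, X = gen c t * U ∧ Y = gen c s * U := by
  have := hr s t X Y hG he
  rwa [h.1, h.2] at this

theorem Reduces.braided (hr : Reduces c G) (h : Braided c s t) {X Y : Mon c}
    (hG : G (gen c s * X)) (he : gen c s * X = gen c t * Y) :
    ∃ U, X = gen c t * (gen c s * U) ∧ Y = gen c s * (gen c t * U) := by
  have := hr s t X Y hG he
  simpa only [h.1, h.2, map_mul, mul_assoc] using this

theorem Reduces.cancel (hr : Reduces c G) {X Y : Mon c} (hG : G (gen c s * X))
    (he : gen c s * X = gen c s * Y) : X = Y := by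
  obtain ⟨U, h1, h2⟩ := hr s s X Y hG he
  rw [h1, h2]

theorem cube_left (hc : ∀ s, c s s = 1) (s t : S) : Cube c G s s t := by
  intro Z Z' _ he
  rw [hc, map_one, one_mul] at he
  exact ⟨Z', by rw [hc, map_one, one_mul, he], rfl⟩

theorem cube_ends (hc : ∀ s, c s s = 1) (hr : Reduces c G) (hG : ∀ A B, G (A * B) → G B) (s r : S) :
    Cube c G s r s := by
  have key : ∀ (w : FreeMonoid S) (X Y : Mon c), G (word c w * X) →
      word c w * X = word c w * Y → X = Y := by
    intro w
    induction w with
    | one => simp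
    | of t => exact fun X Y h he => hr.cancel h he
    | mul u v hu hv =>
      intro X Y h he
      rw [map_mul, mul_assoc] at h
      rw [map_mul, mul_assoc, mul_assoc] at he
      exact hv _ _ (hG _ _ h) (hu _ _ h he)
  intro Z Z' h he
  obtain rfl := key _ _ _ h he
  exact ⟨word c (c s r) * Z, by rw [hc, map_one, one_mul], by rw [hc, map_one, one_mul]⟩

theorem cube_comm_comm_comm (hr : Reduces c G) (hsr : Comm c r s) (hrt : Comm c r t)
    (hst : Comm c s t) : Cube c G s r t := by
  intro Z Z' h he
  rw [hsr.1] at h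
  rw [hsr.1, hrt.1] at he
  rw [hsr.2, hrt.2, hst.1, hst.2]
  obtain ⟨U, rfl, rfl⟩ := hr.comm hst h he
  exact ⟨gen c r * U, hrt.gen_mul U, hsr.gen_mul U⟩

theorem cube_braided_comm_comm (hr : Reduces c G) (hG : ∀ A B, G (A * B) → G B)
    (hsr : Braided c r s) (hrt : Comm c r t) (hst : Comm c s t) : Cube c G s r t := by
  intro Z Z' h he
  simp only [hsr.1, hsr.2, hrt.1, hrt.2, hst.1, hst.2, map_mul, mul_assoc] at h he ⊢
  obtain ⟨U, e1, rfl⟩ := hr.comm hst h he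
  obtain ⟨V, rfl, rfl⟩ := hr.comm hrt (hG _ _ h) e1
  refine ⟨gen c r * (gen c s * V), ?_, ?_⟩
  · rw [hst.gen_mul, hrt.gen_mul]
  · rw [hsr.gen_mul]

theorem cube_comm_comm_braided (hr : Reduces c G) (hsr : Comm c r s) (hrt : Comm c r t)
    (hst : Braided c s t) : Cube c G s r t := by
  intro Z Z' h he
  simp only [hsr.1, hsr.2, hrt.1, hrt.2, hst.1, hst.2, map_mul, mul_assoc] at h he ⊢
  obtain ⟨U, rfl, rfl⟩ := hr.braided hst h he
  refine ⟨gen c r * U, ?_, ?_⟩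
  · rw [hrt.gen_mul, hsr.gen_mul]
  · rw [hsr.gen_mul, hrt.gen_mul]

theorem cube_braided_braided_comm (hr : Reduces c G) (hG : ∀ A B, G (A * B) → G B)
    (hsr : Braided c r s) (hrt : Braided c r t) (hst : Comm c s t) : Cube c G s r t := by
  intro Z Z' h he
  simp only [hsr.1, hsr.2, hrt.1, hrt.2, hst.1, hst.2, map_mul, mul_assoc] at h he ⊢
  obtain ⟨V, e1, e2⟩ := hr.comm hst h he
  obtain ⟨W, rfl, rfl⟩ := hr.braided hrt (hG _ _ h) e1
  have h' := hG _ _ (he ▸ h)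
  obtain ⟨W', rfl, e3⟩ := hr.braided hsr h' e2
  have h3 : G (gen c r * (gen c t * W)) := by
    rw [e2] at h'
    exact hG _ _ h'
  have e4 := hr.cancel h3 e3
  obtain ⟨K, rfl, rfl⟩ := hr.comm hst.symm (hG _ _ h3) e4
  refine ⟨gen c r * (gen c t * (gen c s * (gen c r * K))), ?_, ?_⟩
  · rw [hst.gen_mul, hsr.symm.gen_mul, hrt.gen_mul]
  · rw [hst.symm.gen_mul, hrt.symm.gen_mul, hsr.gen_mul, hst.symm.gen_mul]

theorem cube_braided_comm_braided (hr : Reduces c G) (hG : ∀ A B, G (A * B) → G B)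
    (hsr : Braided c r s) (hrt : Comm c r t) (hst : Braided c s t) : Cube c G s r t := by
  intro Z Z' h he
  simp only [hsr.1, hsr.2, hrt.1, hrt.2, hst.1, hst.2, map_mul, mul_assoc] at h he ⊢
  obtain ⟨V, e1, rfl⟩ := hr.braided hst h he
  obtain ⟨W, rfl, e2⟩ := hr.comm hrt (hG _ _ h) e1
  have h' : G (gen c s * V) := by
    have := hG _ _ h
    rw [e1] at this
    exact hG _ _ this
  obtain ⟨K, rfl, rfl⟩ := hr.braided hsr.symm h' e2
  refine ⟨gen c r * (gen c s * (gen c t * K)), ?_, ?_⟩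
  · rw [hst.gen_mul, hrt.gen_mul, hrt.symm.gen_mul K, hsr.gen_mul]
  · rw [hrt.symm.gen_mul, hsr.gen_mul, hst.gen_mul, hrt.gen_mul]

end Complemented

/-! ### Data extracted from a Garside monoid -/

/-- The complement, the Garside automorphism and the norm of a Garside monoid. -/
structure GarsideData (M : Type*) [Monoid M] (h : M) where
  /-- The automorphism given by conjugation by the Garside element. -/
  τ : M ≃* M
  mul_h : ∀ y, y * h = h * τ y
  /-- The complement `a \ b`, such that `a * (a \ b)` is the right lcm of `a` and `b`. -/
  cp : M → M → M
  mul_cp : ∀ a b, a * cp a b = b * cp b a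
  exists_of_mul_eq : ∀ a b x y, a * x = b * y → ∃ z, x = cp a b * z ∧ y = cp b a * z
  cp_self : ∀ a, cp a a = 1
  left_cancel : ∀ a b c : M, a * b = a * c → b = c
  h_ne_one : ∀ y : M, y ≠ 1 → h ≠ 1
  /-- The norm. -/
  ν : M → ℕ
  ν_eq_zero : ∀ a, ν a = 0 ↔ a = 1
  ν_mul : ∀ a b, ν a + ν b ≤ ν (a * b)

theorem IsGarside.exists_mulEquiv {M : Type*} [Monoid M] {h : M} (H : IsGarside M h) :
    ∃ τ : M ≃* M, ∀ y, y * h = h * τ y := by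
  obtain ⟨-, -, hl, hr, -, -, -, -, -, -, hg, hd⟩ := H
  have h1 : ∀ y : M, ∃ z, y * h = h * z := by
    intro y
    have hy : y ∈ Submonoid.closure {x : M | leftDvd x h} := hg ▸ Submonoid.mem_top y
    induction hy using Submonoid.closure_induction with
    | mem x hx =>
      obtain ⟨x', hx'⟩ := hx
      obtain ⟨x'', hx''⟩ : leftDvd x' h := (Set.ext_iff.1 hd x').2 ⟨x, hx'⟩
      exact ⟨x'', by rw [← hx'', ← mul_assoc, hx', hx'']⟩
    | one => exact ⟨1, by simp⟩
    | mul x y _ _ hx hy =>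
      obtain ⟨x', hx⟩ := hx
      obtain ⟨y', hy⟩ := hy
      exact ⟨x' * y', by rw [mul_assoc, hy, ← mul_assoc, hx, mul_assoc]⟩
  have h2 : ∀ z : M, ∃ y, y * h = h * z := by
    intro y
    have hy : y ∈ Submonoid.closure {x : M | leftDvd x h} := hg ▸ Submonoid.mem_top y
    induction hy using Submonoid.closure_induction with
    | mem x hx =>
      obtain ⟨x', hx'⟩ := (Set.ext_iff.1 hd x).1 hx
      obtain ⟨x'', hx''⟩ := (Set.ext_iff.1 hd x').1 ⟨x, hx'⟩
      exact ⟨x'', by rw [← hx', ← mul_assoc, hx'', hx']⟩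
    | one => exact ⟨1, by simp⟩
    | mul x y _ _ hx hy =>
      obtain ⟨x', hx⟩ := hx
      obtain ⟨y', hy⟩ := hy
      exact ⟨x' * y', by rw [mul_assoc, hy, ← mul_assoc, hx, mul_assoc]⟩
  choose f hf using h1
  choose g hg using h2
  refine ⟨⟨⟨f, g, fun y => hr h _ _ ?_, fun z => hl h _ _ ?_⟩, fun x y => hl h _ _ ?_⟩, hf⟩
  · rw [hg, hf]
  · rw [← hf, hg]
  · change h * f (x * y) = h * (f x * f y)
    rw [← hf, mul_assoc, hf y, ← mul_assoc, hf x, mul_assoc]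

theorem IsGarside.nonempty_data {M : Type*} [Monoid M] {h : M} (H : IsGarside M h) :
    Nonempty (GarsideData M h) := by
  obtain ⟨τ, hτ⟩ := H.exists_mulEquiv
  obtain ⟨-, ⟨ν, h0, hν⟩, hl, -, ha, -, hj, -, -, -, hg, -⟩ := H
  choose j hja hjb hjm using hj
  have hjcomm : ∀ a b, j a b = j b a := fun a b =>
    ha _ _ (hjm a b _ (hjb b a) (hja b a)) (hjm b a _ (hjb a b) (hja a b))
  choose cp hcp using hja
  have hcp' : ∀ a b, b * cp b a = j a b := fun a b => by rw [hcp, hjcomm]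
  refine ⟨⟨τ, hτ, cp, fun a b => by rw [hcp, hcp'], ?_, ?_, hl, ?_, ν, h0, hν⟩⟩
  · intro a b x y he
    obtain ⟨z, hz⟩ := hjm a b (a * x) ⟨x, rfl⟩ ⟨y, he.symm⟩
    refine ⟨z, hl a _ _ ?_, hl b _ _ ?_⟩
    · rw [← mul_assoc, hcp, hz]
    · rw [← mul_assoc, hcp', hz, he]
  · intro a
    have h1 : j a a = a := ha _ _ (hjm a a a ⟨1, mul_one a⟩ ⟨1, mul_one a⟩) (hjb a a)
    exact hl a _ _ (by rw [hcp, h1, mul_one])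
  · rintro y hy rfl
    refine hy ?_
    have hsub : {x : M | leftDvd x 1} ⊆ ((⊥ : Submonoid M) : Set M) := by
      rintro x ⟨c, hc⟩
      refine (h0 x).1 ?_
      have h1 := hν x c
      rw [hc, (h0 1).2 rfl] at h1
      omega
    have h2 : (⊤ : Submonoid M) ≤ ⊥ := hg ▸ Submonoid.closure_le.2 hsub
    exact Submonoid.mem_bot.1 (h2 (Submonoid.mem_top y))

/-! ### The presented monoid -/

namespace GarsideData

open Complemented FreeMonoid

variable {M : Type*} [Monoid M] {h : M} (d : GarsideData M h) {m : ℕ}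

variable (M m) in
/-- The nontrivial elements of `M`, and the braid letters. -/
abbrev Letter : Type _ := {y : M // y ≠ 1} ⊕ Fin m

/-- The word of length at most one representing an element of `M`. -/
noncomputable def emb (y : M) : FreeMonoid (Letter M m) :=
  open Classical in if hy : y = 1 then 1 else of (Sum.inl ⟨y, hy⟩)

theorem emb_one : emb (m := m) (1 : M) = 1 := dif_pos rfl

theorem emb_coe (y : {y : M // y ≠ 1}) : emb (m := m) (y : M) = of (Sum.inl y) :=
  dif_neg y.2

/-- The word consisting of a single braid letter. -/
def sg (i : Fin m) : FreeMonoid (Letter M m) := of (Sum.inr i)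

/-- The complement on letters. -/
noncomputable def compl : Letter M m → Letter M m → FreeMonoid (Letter M m)
  | Sum.inl x, Sum.inl y => emb (d.cp x y)
  | Sum.inl _, Sum.inr i => if i.val = 0 then sg i * emb h * sg i else sg i
  | Sum.inr i, Sum.inl y => if i.val = 0 then emb h * sg i * emb (d.τ y) else emb (y : M)
  | Sum.inr i, Sum.inr j =>
    if i = j then 1 else if i.val + 1 = j.val ∨ j.val + 1 = i.val then sg j * sg i else sg j

theorem compl_self (s : Letter M m) : d.compl s s = 1 := by
  rcases s with x | i
  · simp [compl, d.cp_self, emb_one]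
  · simp [compl]

theorem compl_comm_inl (x : {y : M // y ≠ 1}) {i : Fin m} (hi : i.val ≠ 0) :
    Comm d.compl (Sum.inl x) (Sum.inr i) :=
  ⟨if_neg hi, (if_neg hi).trans (emb_coe x)⟩

theorem compl_comm {i j : Fin m} (hij : i ≠ j) (h1 : i.val + 1 ≠ j.val) (h2 : j.val + 1 ≠ i.val) :
    Comm d.compl (Sum.inr i) (Sum.inr j) := by
  constructor
  · simp [compl, hij, h1, h2, sg]
  · simp [compl, hij.symm, h1, h2, sg]

theorem compl_braided {i j : Fin m} (hij : i.val + 1 = j.val) :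
    Braided d.compl (Sum.inr i) (Sum.inr j) := by
  have h1 : i ≠ j := fun h => by simp [h] at hij
  constructor
  · simp [compl, hij, h1, sg]
  · simp [compl, hij, h1.symm, sg]

/-- The monoid generated by `M` and `m` braid letters. -/
abbrev N (m : ℕ) : Type _ := Mon (d.compl (m := m))

/-- The inclusion of `M`. -/
noncomputable def ι (m : ℕ) : M →* d.N m where
  toFun y := word d.compl (emb y)
  map_one' := by rw [emb_one, map_one]
  map_mul' x y := by
    by_cases hx : x = 1
    · simp [hx, emb_one]
    by_cases hxy : x * y = 1
    · have h1 := d.ν_mul x y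
      rw [hxy, (d.ν_eq_zero 1).2 rfl] at h1
      exact absurd ((d.ν_eq_zero x).1 (by omega)) hx
    have h1 := gen_mul_word (d.compl (m := m)) (Sum.inl ⟨x, hx⟩) (Sum.inl ⟨x * y, hxy⟩)
    have h2 : d.cp x (x * y) = y ∧ d.cp (x * y) x = 1 := by
      obtain ⟨z, hz1, hz2⟩ := d.exists_of_mul_eq x (x * y) y 1 (mul_one _).symm
      have h3 := d.ν_mul (d.cp (x * y) x) z
      rw [← hz2, (d.ν_eq_zero 1).2 rfl] at h3
      have h4 := (d.ν_eq_zero z).1 (by omega)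
      rw [h4, mul_one] at hz1 hz2
      exact ⟨hz1.symm, hz2.symm⟩
    simp only [compl, h2.1, h2.2, emb_one, map_one, mul_one] at h1
    rw [gen, gen, ← emb_coe, ← emb_coe] at h1
    exact h1.symm

/-- The braid generators. -/
noncomputable def s (i : Fin m) : d.N m := gen d.compl (Sum.inr i)

theorem word_emb (y : M) : word d.compl (emb y) = d.ι m y := rfl

theorem word_sg (i : Fin m) : word d.compl (sg i) = d.s i := rfl

theorem gen_inr (i : Fin m) : gen d.compl (Sum.inr i) = d.s i := rfl

theorem gen_inl (y : {y : M // y ≠ 1}) : gen d.compl (Sum.inl y) = d.ι m y := by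
  rw [← word_emb, emb_coe]

theorem s_mul_s {i j : Fin m} (h1 : i.val + 2 ≤ j.val) : d.s i * d.s j = d.s j * d.s i := by
  have := (d.compl_comm (i := i) (j := j) (by rintro rfl; omega) (by omega) (by omega)).gen_mul 1
  simpa only [mul_one, gen_inr] using this

theorem braid {i j : Fin m} (h1 : i.val + 1 = j.val) :
    d.s i * d.s j * d.s i = d.s j * d.s i * d.s j := by
  have := (d.compl_braided h1).gen_mul 1
  simpa only [mul_one, gen_inr, ← mul_assoc] using this

theorem ι_mul_s (y : M) {i : Fin m} (hi : i.val ≠ 0) : d.ι m y * d.s i = d.s i * d.ι m y := by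
  by_cases hy : y = 1
  · simp [hy]
  · have := (d.compl_comm_inl ⟨y, hy⟩ hi).gen_mul 1
    simpa only [mul_one, gen_inl, gen_inr] using this

theorem ι_mul_shs (y : M) {i : Fin m} (hi : i.val = 0) :
    d.ι m y * (d.s i * d.ι m h * d.s i) = d.s i * d.ι m h * d.s i * d.ι m (d.τ y) := by
  by_cases hy : y = 1
  · simp [hy]
  · have := gen_mul_word d.compl (Sum.inl ⟨y, hy⟩) (Sum.inr i)
    simpa only [compl, hi, if_true, map_mul, word_emb, word_sg, gen_inr, gen_inl, mul_assoc]
      using this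

/-- Homomorphisms out of the presented monoid. -/
noncomputable def lift {P : Type*} [Monoid P] (f : M →* P) (g : Fin m → P)
    (hcomm : ∀ i j : Fin m, i.val + 2 ≤ j.val → g i * g j = g j * g i)
    (hbraid : ∀ i j : Fin m, i.val + 1 = j.val → g i * g j * g i = g j * g i * g j)
    (hf : ∀ y (i : Fin m), i.val ≠ 0 → f y * g i = g i * f y)
    (hfh : ∀ y (i : Fin m), i.val = 0 →
      f y * (g i * f h * g i) = g i * f h * g i * f (d.τ y)) : d.N m →* P :=
  PresentedMonoid.lift (rels := rels d.compl)
    (Sum.elim (fun y : {y : M // y ≠ 1} => f y) g) <| by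
    have he : ∀ y : M, FreeMonoid.lift (Sum.elim (fun y : {y : M // y ≠ 1} => f y) g) (emb y) =
        f y := by
      intro y
      by_cases hy : y = 1
      · simp [hy, emb_one]
      · exact (congrArg _ (emb_coe ⟨y, hy⟩)).trans (by simp)
    have hs : ∀ i, FreeMonoid.lift (Sum.elim (fun y : {y : M // y ≠ 1} => f y) g) (sg i) =
        g i := fun i => by simp [sg]
    rintro _ _ ⟨x | i, y | j, rfl, rfl⟩
    · rw [map_mul, map_mul, lift_eval_of, lift_eval_of, compl, compl, he, he, Sum.elim_inl,
        Sum.elim_inl, ← map_mul, ← map_mul, d.mul_cp]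
    · by_cases hj : j.val = 0
      · simpa [compl, hj, he, hs, mul_assoc] using hfh x j hj
      · simpa [compl, hj, he, hs, mul_assoc] using hf x j hj
    · by_cases hj : i.val = 0
      · simpa [compl, hj, he, hs, mul_assoc] using (hfh y i hj).symm
      · simpa [compl, hj, he, hs, mul_assoc] using (hf y i hj).symm
    · rcases lt_trichotomy i j with hij | rfl | hij
      · by_cases h1 : i.val + 1 = j.val
        · simpa [compl, hij.ne, hij.ne', h1, hs, mul_assoc] using hbraid i j h1
        · have h2 : j.val + 1 ≠ i.val := by omega
          simpa [compl, hij.ne, hij.ne', h1, h2, hs] using hcomm i j (by omega)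
      · rfl
      · by_cases h1 : j.val + 1 = i.val
        · simpa [compl, hij.ne, hij.ne', h1, hs, mul_assoc] using (hbraid j i h1).symm
        · have h2 : i.val + 1 ≠ j.val := by omega
          simpa [compl, hij.ne, hij.ne', h1, h2, hs] using (hcomm j i (by omega)).symm

section

variable {P : Type*} [Monoid P] (f : M →* P) (g : Fin m → P)
    (hcomm : ∀ i j : Fin m, i.val + 2 ≤ j.val → g i * g j = g j * g i)
    (hbraid : ∀ i j : Fin m, i.val + 1 = j.val → g i * g j * g i = g j * g i * g j)
    (hf : ∀ y (i : Fin m), i.val ≠ 0 → f y * g i = g i * f y)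
    (hfh : ∀ y (i : Fin m), i.val = 0 →
      f y * (g i * f h * g i) = g i * f h * g i * f (d.τ y))

@[simp]
theorem lift_s (i : Fin m) : d.lift f g hcomm hbraid hf hfh (d.s i) = g i :=
  PresentedMonoid.lift_of _ _

@[simp]
theorem lift_ι (y : M) : d.lift f g hcomm hbraid hf hfh (d.ι m y) = f y := by
  by_cases hy : y = 1
  · simp [hy]
  · rw [← d.gen_inl ⟨y, hy⟩]
    exact PresentedMonoid.lift_of _ _

end

theorem hom_ext {P : Type*} [Monoid P] {f g : d.N m →* P} (h1 : ∀ y, f (d.ι m y) = g (d.ι m y))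
    (h2 : ∀ i, f (d.s i) = g (d.s i)) : f = g := by
  refine PresentedMonoid.ext _ ?_
  rintro (y | i)
  · have := h1 y
    rwa [← gen_inl] at this
  · exact h2 i

theorem closure_eq_top :
    Submonoid.closure (Set.range (d.ι m) ∪ Set.range d.s) = (⊤ : Submonoid (d.N m)) := by
  rw [eq_top_iff, ← PresentedMonoid.closure_range_of, Submonoid.closure_le]
  rintro _ ⟨y | i, rfl⟩
  · exact Submonoid.subset_closure (Or.inl ⟨y, (d.gen_inl y).symm⟩)
  · exact Submonoid.subset_closure (Or.inr ⟨i, rfl⟩)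

/-- The projection onto `M` killing the braid generators. -/
noncomputable def π (m : ℕ) : d.N m →* M :=
  d.lift (MonoidHom.id M) (fun _ => 1) (by simp) (by simp) (by simp) (by simp [d.mul_h])

/-- The number of braid generators. -/
noncomputable def len (m : ℕ) : d.N m →* Multiplicative ℕ :=
  d.lift 1 (fun _ => Multiplicative.ofAdd 1) (by simp) (by simp) (by simp) (by simp)

/-- The norm on the presented monoid. -/
noncomputable def norm (x : d.N m) : ℕ := d.ν (d.π m x) + (d.len m x).toAdd

theorem norm_mul (a b : d.N m) : d.norm a + d.norm b ≤ d.norm (a * b) := by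
  have := d.ν_mul (d.π m a) (d.π m b)
  simp only [norm, map_mul, toAdd_mul]
  omega

theorem norm_gen_pos (s : Letter M m) : 0 < d.norm (gen d.compl s) := by
  rcases s with y | i
  · have : d.ν y ≠ 0 := fun h => y.2 ((d.ν_eq_zero _).1 h)
    rw [gen_inl, norm, π, lift_ι]
    exact Nat.add_pos_left (Nat.pos_of_ne_zero this) _
  · rw [gen_inr, norm, len, lift_s]
    simp

theorem norm_eq_zero (a : d.N m) : d.norm a = 0 ↔ a = 1 := by
  constructor
  · intro ha
    rcases eq_one_or_gen_mul _ a with rfl | ⟨s, y, rfl⟩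
    · rfl
    · have h1 := d.norm_mul (gen d.compl s) y
      have h2 := d.norm_gen_pos s
      omega
  · rintro rfl
    simp [norm, (d.ν_eq_zero 1).2 rfl]

end GarsideData

/-! ### The cube condition -/

namespace GarsideData

open Complemented FreeMonoid

variable {M : Type*} [Monoid M] {h : M} (d : GarsideData M h) {m : ℕ}

theorem τ_h : d.τ h = h := d.left_cancel h _ _ (d.mul_h h).symm

theorem τ_eq_one {y : M} : d.τ y = 1 ↔ y = 1 := EmbeddingLike.map_eq_one_iff

theorem cp_one (b : M) : d.cp 1 b = b ∧ d.cp b 1 = 1 := by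
  obtain ⟨z, h1, h2⟩ := d.exists_of_mul_eq 1 b b 1 (by simp)
  have h3 := d.ν_mul (d.cp b 1) z
  rw [← h2, (d.ν_eq_zero 1).2 rfl] at h3
  have h4 := (d.ν_eq_zero z).1 (by omega)
  rw [h4, mul_one] at h1 h2
  exact ⟨h1.symm, h2.symm⟩

section words

variable (x y : {y : M // y ≠ 1}) {i j : Fin m}

theorem word_inl_inl : word (d.compl (m := m)) (d.compl (Sum.inl x) (Sum.inl y)) =
    d.ι m (d.cp x y) := rfl

theorem word_inl_zero (hi : i.val = 0) : word d.compl (d.compl (Sum.inl x) (Sum.inr i)) =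
    d.s i * (d.ι m h * d.s i) := by
  rw [compl, if_pos hi, map_mul, map_mul, mul_assoc]
  rfl

theorem word_zero_inl (hi : i.val = 0) : word d.compl (d.compl (Sum.inr i) (Sum.inl x)) =
    d.ι m h * (d.s i * d.ι m (d.τ x)) := by
  rw [compl, if_pos hi, map_mul, map_mul, mul_assoc]
  rfl

theorem word_inl_pos (hi : i.val ≠ 0) : word d.compl (d.compl (Sum.inl x) (Sum.inr i)) =
    d.s i := by
  rw [compl, if_neg hi]
  rfl

theorem word_pos_inl (hi : i.val ≠ 0) : word d.compl (d.compl (Sum.inr i) (Sum.inl x)) =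
    d.ι m x := by
  rw [compl, if_neg hi]
  rfl

end words

theorem ι_mul_s_mul (y : M) {i : Fin m} (hi : i.val ≠ 0) (Z : d.N m) :
    d.ι m y * (d.s i * Z) = d.s i * (d.ι m y * Z) := by
  rw [← mul_assoc, d.ι_mul_s y hi, mul_assoc]

theorem ι_mul_shs_mul (y : M) {i : Fin m} (hi : i.val = 0) (Z : d.N m) :
    d.ι m y * (d.s i * (d.ι m h * (d.s i * Z))) =
      d.s i * (d.ι m h * (d.s i * (d.ι m (d.τ y) * Z))) := by
  have := congrArg (· * Z) (d.ι_mul_shs y hi)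
  simpa only [mul_assoc] using this

theorem s_mul_s_mul {i j : Fin m} (h1 : i.val + 2 ≤ j.val) (Z : d.N m) :
    d.s i * (d.s j * Z) = d.s j * (d.s i * Z) := by
  rw [← mul_assoc, d.s_mul_s h1, mul_assoc]

theorem braid_mul {i j : Fin m} (h1 : i.val + 1 = j.val) (Z : d.N m) :
    d.s i * (d.s j * (d.s i * Z)) = d.s j * (d.s i * (d.s j * Z)) := by
  have := congrArg (· * Z) (d.braid h1)
  simpa only [mul_assoc] using this

section reduction

variable {d} {G : d.N m → Prop} (hr : Reduces d.compl G) {a b : M} {i : Fin m} {X Y : d.N m}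
include hr

theorem reduces_ι_ι (hX : G (d.ι m a * X)) (he : d.ι m a * X = d.ι m b * Y) :
    ∃ U, X = d.ι m (d.cp a b) * U ∧ Y = d.ι m (d.cp b a) * U := by
  by_cases ha : a = 1
  · subst ha
    exact ⟨Y, by simpa [d.cp_one] using he, by simp [d.cp_one]⟩
  by_cases hb : b = 1
  · subst hb
    exact ⟨X, by simp [d.cp_one], by simpa [d.cp_one] using he.symm⟩
  have := hr (Sum.inl ⟨a, ha⟩) (Sum.inl ⟨b, hb⟩) X Y
  simp only [gen_inl, word_inl_inl] at this
  exact this hX he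

theorem cancel_ι (hX : G (d.ι m a * X)) (he : d.ι m a * X = d.ι m a * Y) : X = Y := by
  obtain ⟨U, h1, h2⟩ := reduces_ι_ι hr hX he
  rw [h1, h2]

theorem cancel_s (hX : G (d.s i * X)) (he : d.s i * X = d.s i * Y) : X = Y := by
  obtain ⟨U, h1, h2⟩ := hr (Sum.inr i) (Sum.inr i) X Y hX he
  rw [h1, h2]

theorem reduces_ι_zero (ha : a ≠ 1) (hi : i.val = 0) (hX : G (d.ι m a * X))
    (he : d.ι m a * X = d.s i * Y) :
    ∃ U, X = d.s i * (d.ι m h * (d.s i * U)) ∧ Y = d.ι m h * (d.s i * (d.ι m (d.τ a) * U)) := by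
  have := hr (Sum.inl ⟨a, ha⟩) (Sum.inr i) X Y
  simp only [gen_inl, gen_inr, word_inl_zero _ _ hi, word_zero_inl _ _ hi, mul_assoc] at this
  exact this hX he

theorem reduces_ι_pos (hi : i.val ≠ 0) (hX : G (d.ι m a * X)) (he : d.ι m a * X = d.s i * Y) :
    ∃ U, X = d.s i * U ∧ Y = d.ι m a * U := by
  by_cases ha : a = 1
  · subst ha
    exact ⟨Y, by simpa using he, by simp⟩
  have := hr (Sum.inl ⟨a, ha⟩) (Sum.inr i) X Y
  simp only [gen_inl, gen_inr, word_inl_pos _ _ hi, word_pos_inl _ _ hi] at this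
  exact this hX he

theorem reduces_ι_τ_ι_τ (hX : G (d.ι m (d.τ a) * X))
    (he : d.ι m (d.τ a) * X = d.ι m (d.τ b) * Y) :
    ∃ U, X = d.ι m (d.τ (d.cp a b)) * U ∧ Y = d.ι m (d.τ (d.cp b a)) * U := by
  obtain ⟨U, rfl, rfl⟩ := reduces_ι_ι hr hX he
  obtain ⟨p, hp⟩ := d.τ.surjective (d.cp (d.τ a) (d.τ b))
  obtain ⟨q, hq⟩ := d.τ.surjective (d.cp (d.τ b) (d.τ a))
  obtain ⟨z, rfl, rfl⟩ := d.exists_of_mul_eq a b p q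
    (d.τ.injective (by rw [map_mul, map_mul, hp, hq, d.mul_cp]))
  exact ⟨d.ι m (d.τ z) * U, by rw [← hp, map_mul, map_mul, mul_assoc],
    by rw [← hq, map_mul, map_mul, mul_assoc]⟩

variable (hG : ∀ A B, G (A * B) → G B)
include hG

theorem reduces_ι_shs (hi : i.val = 0) (hX : G (d.ι m a * X))
    (he : d.ι m a * X = d.s i * (d.ι m h * (d.s i * Y))) :
    ∃ U, X = d.s i * (d.ι m h * (d.s i * U)) ∧ Y = d.ι m (d.τ a) * U := by
  by_cases ha : a = 1
  · subst ha
    exact ⟨Y, by simpa using he, by simp⟩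
  · obtain ⟨U, h1, h2⟩ := reduces_ι_zero hr ha hi hX he
    rw [he] at hX
    have h3 := cancel_ι hr (hG _ _ hX) h2
    exact ⟨U, h1, cancel_s hr (hG _ _ (hG _ _ hX)) h3⟩

end reduction

section cube

variable {d} {G : d.N m → Prop} (hr : Reduces d.compl G) {x y z : {y : M // y ≠ 1}} {i j : Fin m}
include hr

theorem cube_ι_ι_ι : Cube d.compl G (Sum.inl x) (Sum.inl y) (Sum.inl z) := by
  intro Z Z' hZ he
  simp only [word_inl_inl] at *
  obtain ⟨V, rfl, rfl⟩ := reduces_ι_ι hr hZ he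
  obtain ⟨e, h1, h2⟩ := d.exists_of_mul_eq x z (d.cp x y * d.cp (d.cp y x) (d.cp y z))
    (d.cp z y * d.cp (d.cp y z) (d.cp y x)) (by
      rw [← mul_assoc, ← mul_assoc, d.mul_cp x y, d.mul_cp z y, mul_assoc, mul_assoc, d.mul_cp])
  exact ⟨d.ι m e * V, by rw [← mul_assoc, ← map_mul, h1, map_mul, mul_assoc],
    by rw [← mul_assoc, ← map_mul, h2, map_mul, mul_assoc]⟩

theorem cube_ι_ι_pos (hi : i.val ≠ 0) :
    Cube d.compl G (Sum.inl x) (Sum.inl y) (Sum.inr i) := by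
  intro Z Z' hZ he
  simp only [word_inl_inl, word_inl_pos _ _ hi, word_pos_inl _ _ hi] at *
  obtain ⟨V, rfl, rfl⟩ := reduces_ι_pos hr hi hZ he
  refine ⟨d.ι m (d.cp x y) * V, d.ι_mul_s_mul _ hi _, ?_⟩
  rw [← mul_assoc, ← mul_assoc, ← map_mul, ← map_mul, d.mul_cp]

theorem cube_ι_pos_ι (hi : i.val ≠ 0) :
    Cube d.compl G (Sum.inl x) (Sum.inr i) (Sum.inl y) := by
  intro Z Z' hZ he
  simp only [word_inl_inl, word_inl_pos _ _ hi, word_pos_inl _ _ hi] at *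
  obtain ⟨V, rfl, rfl⟩ := reduces_ι_ι hr hZ he
  exact ⟨d.s i * V, (d.ι_mul_s_mul _ hi _).symm, (d.ι_mul_s_mul _ hi _).symm⟩

variable (hG : ∀ A B, G (A * B) → G B)
include hG

theorem cube_ι_ι_zero (hi : i.val = 0) :
    Cube d.compl G (Sum.inl x) (Sum.inl y) (Sum.inr i) := by
  intro Z Z' hZ he
  simp only [word_inl_inl, word_inl_zero _ _ hi, word_zero_inl _ _ hi, mul_assoc] at *
  obtain ⟨V, rfl, rfl⟩ := reduces_ι_shs hr hG hi hZ he
  refine ⟨d.ι m (d.τ (d.cp x y)) * V, d.ι_mul_shs_mul _ hi _, ?_⟩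
  rw [← mul_assoc (d.ι m (d.τ y)), ← mul_assoc (d.ι m (d.τ x)), ← map_mul, ← map_mul, ← map_mul,
    ← map_mul, d.mul_cp]

theorem cube_ι_zero_ι (hi : i.val = 0) :
    Cube d.compl G (Sum.inl x) (Sum.inr i) (Sum.inl y) := by
  intro Z Z' hZ he
  simp only [word_inl_inl, word_inl_zero _ _ hi, word_zero_inl _ _ hi, mul_assoc] at *
  have h1 := cancel_s hr (hG _ _ hZ) (cancel_ι hr hZ he)
  obtain ⟨V, rfl, rfl⟩ := reduces_ι_τ_ι_τ hr (hG _ _ (hG _ _ hZ)) h1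
  exact ⟨d.s i * (d.ι m h * (d.s i * V)), (d.ι_mul_shs_mul _ hi _).symm,
    (d.ι_mul_shs_mul _ hi _).symm⟩

end cube

end GarsideData

namespace GarsideData

open Complemented FreeMonoid

variable {M : Type*} [Monoid M] {h : M} {d : GarsideData M h} {m : ℕ}

section mixed

variable {G : d.N m → Prop} (hr : Reduces d.compl G) (hG : ∀ A B, G (A * B) → G B)
  {x : {y : M // y ≠ 1}} {i j : Fin m}

include hr in
theorem reduces_s_s_comm (hij : i.val + 2 ≤ j.val) {X Y : d.N m} (hX : G (d.s i * X))
    (he : d.s i * X = d.s j * Y) : ∃ U, X = d.s j * U ∧ Y = d.s i * U :=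
  hr.comm (d.compl_comm (i := i) (j := j) (by rintro rfl; omega) (by omega) (by omega)) hX he

include hr in
theorem reduces_s_s_braided (hij : i.val + 1 = j.val) {X Y : d.N m} (hX : G (d.s i * X))
    (he : d.s i * X = d.s j * Y) :
    ∃ U, X = d.s j * (d.s i * U) ∧ Y = d.s i * (d.s j * U) := by
  obtain ⟨U, h1, h2⟩ := hr.braided (d.compl_braided hij) hX he
  exact ⟨U, h1, h2⟩

theorem word_s_s_comm (hij : i.val + 2 ≤ j.val) :
    word d.compl (d.compl (Sum.inr i) (Sum.inr j)) = d.s j ∧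
    word d.compl (d.compl (Sum.inr j) (Sum.inr i)) = d.s i := by
  have := d.compl_comm (i := i) (j := j) (by rintro rfl; omega) (by omega) (by omega)
  rw [this.1, this.2]
  exact ⟨rfl, rfl⟩

theorem word_s_s_braided (hij : i.val + 1 = j.val) :
    word d.compl (d.compl (Sum.inr i) (Sum.inr j)) = d.s j * d.s i ∧
    word d.compl (d.compl (Sum.inr j) (Sum.inr i)) = d.s i * d.s j := by
  have := d.compl_braided hij
  rw [this.1, this.2]
  exact ⟨rfl, rfl⟩

theorem cube_zero_ι_far (hr : Reduces d.compl G) (hG : ∀ A B, G (A * B) → G B) (hi : i.val = 0)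
    (hj : 2 ≤ j.val) :
    Cube d.compl G (Sum.inr i) (Sum.inl x) (Sum.inr j) := by
  intro Z Z' hZ he
  have hj0 : j.val ≠ 0 := by omega
  have hij : i.val + 2 ≤ j.val := by omega
  simp only [word_inl_zero _ _ hi, word_zero_inl _ _ hi, word_inl_pos _ _ hj0,
    word_pos_inl _ _ hj0, (word_s_s_comm hij).1, (word_s_s_comm hij).2, mul_assoc] at *
  obtain ⟨V, h1, rfl⟩ := reduces_s_s_comm hr hij hZ he
  obtain ⟨W, h2, rfl⟩ := reduces_ι_pos hr hj0 (hG _ _ hZ) h1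
  obtain ⟨K, rfl, rfl⟩ := reduces_s_s_comm hr hij (hG _ _ (hG _ _ hZ)) h2
  refine ⟨d.ι m h * (d.s i * (d.ι m (d.τ x) * K)), ?_, d.ι_mul_shs_mul _ hi _⟩
  rw [d.ι_mul_s_mul _ hj0, d.s_mul_s_mul hij, d.ι_mul_s_mul _ hj0]

theorem cube_ι_zero_far (hr : Reduces d.compl G) (hG : ∀ A B, G (A * B) → G B) (hi : i.val = 0)
    (hj : 2 ≤ j.val) :
    Cube d.compl G (Sum.inl x) (Sum.inr i) (Sum.inr j) := by
  intro Z Z' hZ he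
  have hj0 : j.val ≠ 0 := by omega
  have hij : i.val + 2 ≤ j.val := by omega
  simp only [word_inl_zero _ _ hi, word_zero_inl _ _ hi, word_inl_pos _ _ hj0,
    word_pos_inl _ _ hj0, (word_s_s_comm hij).1, (word_s_s_comm hij).2, mul_assoc] at *
  obtain ⟨V, h1, rfl⟩ := reduces_ι_pos hr hj0 hZ he
  obtain ⟨W, h2, rfl⟩ := reduces_s_s_comm hr hij (hG _ _ hZ) h1
  obtain ⟨K, rfl, rfl⟩ := reduces_ι_pos hr hj0 (hG _ _ (hG _ _ hZ)) h2
  refine ⟨d.s i * (d.ι m h * (d.s i * K)), ?_, (d.ι_mul_shs_mul _ hi _).symm⟩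
  rw [d.s_mul_s_mul hij, d.ι_mul_s_mul _ hj0, d.s_mul_s_mul hij]

theorem cube_ι_far_zero (hr : Reduces d.compl G) (hi : i.val = 0) (hj : 2 ≤ j.val) :
    Cube d.compl G (Sum.inl x) (Sum.inr j) (Sum.inr i) := by
  intro Z Z' hZ he
  have hj0 : j.val ≠ 0 := by omega
  have hij : i.val + 2 ≤ j.val := by omega
  simp only [word_inl_zero _ _ hi, word_zero_inl _ _ hi, word_inl_pos _ _ hj0,
    word_pos_inl _ _ hj0, (word_s_s_comm hij).1, (word_s_s_comm hij).2, mul_assoc] at *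
  obtain ⟨V, rfl, rfl⟩ := reduces_ι_zero hr x.2 hi hZ he
  refine ⟨d.s j * V, ?_, ?_⟩
  · rw [d.s_mul_s_mul hij, d.ι_mul_s_mul _ hj0, d.s_mul_s_mul hij]
  · rw [d.ι_mul_s_mul _ hj0, d.s_mul_s_mul hij, d.ι_mul_s_mul _ hj0]

theorem shststhst (hi : i.val = 0) (hj : j.val = 1) (Z : d.N m) :
    d.s i * (d.ι m h * (d.s i * (d.s j * (d.s i * (d.ι m h * (d.s i * Z)))))) =
    d.s i * (d.s j * (d.ι m h * (d.s i * (d.ι m h * (d.s j * (d.s i * Z)))))) := by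
  have hj0 : j.val ≠ 0 := by omega
  have hij : i.val + 1 = j.val := by omega
  rw [d.braid_mul hij, d.ι_mul_s_mul _ hj0, ← d.ι_mul_s_mul h hj0 (d.s i * Z)]

theorem lcm_eq_s (hi : i.val = 0) (hj : j.val = 1) (Z : d.N m) :
    d.s i * (d.ι m h * (d.s i * (d.s j * (d.s i * (d.ι m h * (d.s i * (d.s j * Z))))))) =
    d.s j * (d.s i * (d.s j * (d.ι m h * (d.s i * (d.ι m h * (d.s j * (d.s i * Z))))))) := by
  have hij : i.val + 1 = j.val := by omega
  rw [shststhst hi hj, ← d.braid_mul hij, d.ι_mul_shs_mul _ hi, d.τ_h, d.braid_mul hij]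

theorem lcm_eq_t (y : M) (hi : i.val = 0) (hj : j.val = 1) (Z : d.N m) :
    d.ι m h * (d.s i * (d.ι m (d.τ y) * (d.s j * (d.s i * (d.ι m h * (d.s i * (d.s j * Z))))))) =
    d.s j * (d.s i * (d.ι m h * (d.s i * (d.ι m h * (d.s j * (d.s i *
      (d.ι m (d.τ (d.τ y)) * Z))))))) := by
  have hj0 : j.val ≠ 0 := by omega
  have hij : i.val + 1 = j.val := by omega
  rw [d.ι_mul_s_mul (d.τ y) hj0, d.ι_mul_shs_mul (d.τ y) hi, d.ι_mul_s_mul (d.τ (d.τ y)) hj0,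
    d.braid_mul hij, d.ι_mul_s_mul h hj0, ← d.ι_mul_s_mul h hj0 (d.s i * (d.s j * (d.ι m _ * Z))),
    ← d.braid_mul hij, d.ι_mul_shs_mul h hi, d.τ_h]

theorem lcm_eq_x (y : M) (hi : i.val = 0) (hj : j.val = 1) (Z : d.N m) :
    d.ι m y * (d.s i * (d.s j * (d.ι m h * (d.s i * (d.ι m h * (d.s j * (d.s i * Z))))))) =
    d.s i * (d.s j * (d.ι m h * (d.s i * (d.ι m h * (d.s j * (d.s i *
      (d.ι m (d.τ (d.τ y)) * Z))))))) := by
  have hj0 : j.val ≠ 0 := by omega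
  rw [← shststhst hi hj, ← shststhst hi hj, d.ι_mul_shs_mul y hi, d.ι_mul_s_mul (d.τ y) hj0,
    d.ι_mul_shs_mul (d.τ y) hi]

theorem cube_zero_ι_one (hr : Reduces d.compl G) (hG : ∀ A B, G (A * B) → G B) (hi : i.val = 0)
    (hj : j.val = 1) :
    Cube d.compl G (Sum.inr i) (Sum.inl x) (Sum.inr j) := by
  intro Z Z' hZ he
  have hj0 : j.val ≠ 0 := by omega
  have hij : i.val + 1 = j.val := by omega
  have hh := d.h_ne_one x x.2
  simp only [word_inl_zero _ _ hi, word_zero_inl _ _ hi, word_inl_pos _ _ hj0,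
    word_pos_inl _ _ hj0, (word_s_s_braided hij).1, (word_s_s_braided hij).2, mul_assoc] at *
  obtain ⟨V, h1, rfl⟩ := reduces_s_s_braided hr hij hZ he
  have g1 := hG _ _ hZ
  obtain ⟨W, h2, h3⟩ := reduces_ι_pos hr hj0 g1 h1
  obtain ⟨K, rfl, rfl⟩ := reduces_s_s_braided hr hij (hG _ _ g1) h2
  have g2 : G (d.ι m h * (d.s i * (d.s j * K))) := by
    rw [h1, h3] at g1
    exact hG _ _ g1
  obtain ⟨A, h4, rfl⟩ := reduces_ι_zero hr hh hi g2 h3.symm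
  have g3 := hG _ _ (hG _ _ g2)
  have h5 := cancel_s hr (hG _ _ g2) h4
  rw [h5] at g3
  obtain ⟨B, h6, h7⟩ := reduces_ι_pos hr hj0 g3 h5.symm
  obtain ⟨C, rfl, rfl⟩ := reduces_s_s_braided hr hij (hG _ _ g3) h6
  subst h7
  refine ⟨d.ι m h * (d.s i * (d.ι m h * (d.s j * (d.s i * (d.ι m (d.τ (d.τ x)) * C))))), ?_, ?_⟩
  · rw [lcm_eq_t _ hi hj]
  · rw [d.τ_h, lcm_eq_x _ hi hj]

theorem cube_ι_zero_one (hr : Reduces d.compl G) (hG : ∀ A B, G (A * B) → G B) (hi : i.val = 0)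
    (hj : j.val = 1) :
    Cube d.compl G (Sum.inl x) (Sum.inr i) (Sum.inr j) := by
  intro Z Z' hZ he
  have hj0 : j.val ≠ 0 := by omega
  have hij : i.val + 1 = j.val := by omega
  have hh := d.h_ne_one x x.2
  simp only [word_inl_zero _ _ hi, word_zero_inl _ _ hi, word_inl_pos _ _ hj0,
    word_pos_inl _ _ hj0, (word_s_s_braided hij).1, (word_s_s_braided hij).2, mul_assoc] at *
  obtain ⟨W, h1, h2⟩ := reduces_ι_pos hr hj0 hZ he
  have g1 := hG _ _ hZ
  obtain ⟨V, h3, rfl⟩ := reduces_s_s_braided hr hij g1 h1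
  have g2 := hG _ _ g1
  obtain ⟨A, rfl, h4⟩ := reduces_ι_pos hr hj0 g2 h3
  have g3 : G (d.s i * V) := by
    rw [h3] at g2
    exact hG _ _ g2
  obtain ⟨B, rfl, rfl⟩ := reduces_ι_zero hr (mt d.τ_eq_one.1 x.2) hi (h4 ▸ g3) h4.symm
  have g4 : G (d.ι m h * (d.s i * (d.s j * (d.ι m h * (d.s i * (d.ι m (d.τ (d.τ x)) * B)))))) := by
    rw [he, h2] at hZ
    exact hG _ _ hZ
  obtain ⟨C, h5, rfl⟩ := reduces_ι_zero hr hh hi g4 h2.symm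
  have g5 := hG _ _ g4
  have h6 := cancel_s hr g5 h5
  rw [h6] at g5
  have g6 := hG _ _ g5
  obtain ⟨E, h7, h8⟩ := reduces_ι_pos hr hj0 g6 h6.symm
  obtain ⟨F, rfl, rfl⟩ := reduces_s_s_braided hr hij (hG _ _ g6) h7
  have h9 := cancel_ι hr (hG _ _ (h6 ▸ g6)) h8
  have h10 := cancel_s hr (hG _ _ (hG _ _ (h6 ▸ g6))) h9
  have g7 := hG _ _ (hG _ _ (hG _ _ (h6 ▸ g6)))
  obtain ⟨Y, rfl, rfl⟩ := reduces_ι_pos hr hj0 g7 h10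
  refine ⟨d.s i * (d.s j * (d.ι m h * (d.s i * (d.ι m h * (d.s j * (d.s i * Y)))))), ?_, ?_⟩
  · rw [lcm_eq_s hi hj]
  · rw [d.τ_h, lcm_eq_x _ hi hj]

theorem cube_ι_one_zero (hr : Reduces d.compl G) (hG : ∀ A B, G (A * B) → G B) (hi : i.val = 0)
    (hj : j.val = 1) :
    Cube d.compl G (Sum.inl x) (Sum.inr j) (Sum.inr i) := by
  intro Z Z' hZ he
  have hj0 : j.val ≠ 0 := by omega
  have hij : i.val + 1 = j.val := by omega
  simp only [word_inl_zero _ _ hi, word_zero_inl _ _ hi, word_inl_pos _ _ hj0,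
    word_pos_inl _ _ hj0, (word_s_s_braided hij).1, (word_s_s_braided hij).2, mul_assoc] at *
  obtain ⟨V, rfl, h1⟩ := reduces_ι_zero hr x.2 hi hZ he
  have g1 : G (d.ι m h * (d.s i * (d.ι m (d.τ x) * V))) := by
    rw [he, h1] at hZ
    exact hG _ _ hZ
  obtain ⟨W, h2, rfl⟩ := reduces_ι_pos hr hj0 g1 h1.symm
  have g2 := hG _ _ g1
  obtain ⟨A, h3, rfl⟩ := reduces_s_s_braided hr hij g2 h2
  have g3 := hG _ _ g2
  obtain ⟨B, rfl, h4⟩ := reduces_ι_pos hr hj0 g3 h3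
  have g4 : G (d.ι m (d.τ x) * B) := by
    rw [h3] at g3
    have := hG _ _ g3
    rwa [h4] at this
  obtain ⟨C, rfl, rfl⟩ := reduces_ι_zero hr (mt d.τ_eq_one.1 x.2) hi g4 h4.symm
  refine ⟨d.s j * (d.s i * (d.ι m h * (d.s i * (d.s j * C)))), ?_, ?_⟩
  · rw [lcm_eq_s hi hj, shststhst hi hj]
  · rw [lcm_eq_t _ hi hj, d.ι_mul_s_mul _ hj0]

end mixed

section assembly

variable {G : d.N m → Prop}

theorem comm_or_braided {i j : Fin m} (hij : i < j) :
    Comm d.compl (Sum.inr i) (Sum.inr j) ∧ i.val + 2 ≤ j.val ∨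
    Braided d.compl (Sum.inr i) (Sum.inr j) ∧ i.val + 1 = j.val := by
  by_cases h1 : i.val + 1 = j.val
  · exact Or.inr ⟨d.compl_braided h1, h1⟩
  · exact Or.inl ⟨d.compl_comm hij.ne h1 (by omega), by omega⟩

theorem cube_lt_lt {i j k : Fin m} (hr : Reduces d.compl G) (hG : ∀ A B, G (A * B) → G B)
    (hij : i < j) (hjk : j < k) :
    Cube d.compl G (Sum.inr j) (Sum.inr i) (Sum.inr k) ∧
    Cube d.compl G (Sum.inr i) (Sum.inr j) (Sum.inr k) ∧
    Cube d.compl G (Sum.inr i) (Sum.inr k) (Sum.inr j) := by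
  have hik : Comm d.compl (Sum.inr i) (Sum.inr k) :=
    d.compl_comm (by rintro rfl; omega) (by omega) (by omega)
  rcases comm_or_braided (d := d) hij with ⟨h1, -⟩ | ⟨h1, -⟩ <;>
  rcases comm_or_braided (d := d) hjk with ⟨h2, -⟩ | ⟨h2, -⟩
  · exact ⟨cube_comm_comm_comm hr h1 hik h2, cube_comm_comm_comm hr h1.symm h2 hik,
      cube_comm_comm_comm hr hik.symm h2.symm h1⟩
  · exact ⟨cube_comm_comm_braided hr h1 hik h2,
      (cube_braided_comm_comm hr hG h2 h1.symm hik.symm).symm,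
      (cube_braided_comm_comm hr hG h2.symm hik.symm h1.symm).symm⟩
  · exact ⟨cube_braided_comm_comm hr hG h1 hik h2, cube_braided_comm_comm hr hG h1.symm h2 hik,
      cube_comm_comm_braided hr hik.symm h2.symm h1⟩
  · exact ⟨cube_braided_comm_braided hr hG h1 hik h2,
      cube_braided_braided_comm hr hG h1.symm h2 hik,
      (cube_braided_comm_braided hr hG h2.symm hik.symm h1.symm).symm⟩

theorem cube_ι_lt {i j : Fin m} (x : {y : M // y ≠ 1}) (hr : Reduces d.compl G)
    (hG : ∀ A B, G (A * B) → G B) (hij : i < j) :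
    Cube d.compl G (Sum.inr i) (Sum.inl x) (Sum.inr j) ∧
    Cube d.compl G (Sum.inl x) (Sum.inr i) (Sum.inr j) ∧
    Cube d.compl G (Sum.inl x) (Sum.inr j) (Sum.inr i) := by
  have hj : j.val ≠ 0 := by
    have : i.val < j.val := hij
    omega
  have hxj := d.compl_comm_inl x hj
  by_cases hi : i.val = 0
  · by_cases hj1 : j.val = 1
    · exact ⟨cube_zero_ι_one hr hG hi hj1, cube_ι_zero_one hr hG hi hj1,
        cube_ι_one_zero hr hG hi hj1⟩
    · have hj2 : 2 ≤ j.val := by omega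
      exact ⟨cube_zero_ι_far hr hG hi hj2, cube_ι_zero_far hr hG hi hj2,
        cube_ι_far_zero hr hi hj2⟩
  · have hxi := d.compl_comm_inl x hi
    rcases comm_or_braided (d := d) hij with ⟨h1, -⟩ | ⟨h1, -⟩
    · exact ⟨cube_comm_comm_comm hr hxi hxj h1, cube_comm_comm_comm hr hxi.symm h1 hxj,
        cube_comm_comm_comm hr hxj.symm h1.symm hxi⟩
    · exact ⟨cube_comm_comm_braided hr hxi hxj h1,
        (cube_braided_comm_comm hr hG h1 hxi.symm hxj.symm).symm,
        (cube_braided_comm_comm hr hG h1.symm hxj.symm hxi.symm).symm⟩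

theorem cube (G : d.N m → Prop) (hG : ∀ A B, G (A * B) → G B) (hr : Reduces d.compl G)
    (s r t : Letter M m) : Cube d.compl G s r t := by
  by_cases hsr : s = r
  · subst hsr
    exact cube_left d.compl_self s t
  by_cases hrt : r = t
  · subst hrt
    exact (cube_left d.compl_self r s).symm
  by_cases hst : s = t
  · subst hst
    exact cube_ends d.compl_self hr hG s r
  rcases s with x | i <;> rcases r with y | j <;> rcases t with z | k
  · exact cube_ι_ι_ι hr
  · by_cases hk : k.val = 0
    · exact cube_ι_ι_zero hr hG hk
    · exact cube_ι_ι_pos hr hk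
  · by_cases hj : j.val = 0
    · exact cube_ι_zero_ι hr hG hj
    · exact cube_ι_pos_ι hr hj
  · rcases lt_or_gt_of_ne (fun h => hrt (congrArg _ h) : j ≠ k) with h1 | h1
    · exact (cube_ι_lt x hr hG h1).2.1
    · exact (cube_ι_lt x hr hG h1).2.2
  · by_cases hi : i.val = 0
    · exact (cube_ι_ι_zero hr hG hi).symm
    · exact (cube_ι_ι_pos hr hi).symm
  · rcases lt_or_gt_of_ne (fun h => hst (congrArg _ h) : i ≠ k) with h1 | h1
    · exact (cube_ι_lt y hr hG h1).1
    · exact (cube_ι_lt y hr hG h1).1.symm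
  · rcases lt_or_gt_of_ne (fun h => hsr (congrArg _ h) : i ≠ j) with h1 | h1
    · exact (cube_ι_lt z hr hG h1).2.2.symm
    · exact (cube_ι_lt z hr hG h1).2.1.symm
  · rcases lt_or_gt_of_ne (fun h => hsr (congrArg _ h) : i ≠ j) with h1 | h1 <;>
    rcases lt_or_gt_of_ne (fun h => hrt (congrArg _ h) : j ≠ k) with h2 | h2 <;>
    rcases lt_or_gt_of_ne (fun h => hst (congrArg _ h) : i ≠ k) with h3 | h3
    · exact (cube_lt_lt hr hG h1 h2).2.1
    · exact absurd (h1.trans h2) h3.asymm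
    · exact (cube_lt_lt hr hG h3 h2).2.2
    · exact (cube_lt_lt hr hG h3 h1).2.2.symm
    · exact (cube_lt_lt hr hG h1 h3).1
    · exact (cube_lt_lt hr hG h2 h3).1.symm
    · exact absurd (h2.trans h1) h3.asymm
    · exact (cube_lt_lt hr hG h2 h1).2.1.symm

variable (d m) in
theorem reduces : Reduces (d.compl (m := m)) (fun _ => True) :=
  reduces_of_cube d.norm d.norm_mul d.norm_gen_pos d.compl_self cube

end assembly

end GarsideData

/-! ### The Garside element -/

section garside

variable {P : Type*} [Monoid P] (a : P) (σ : ℕ → P)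

/-- The element `σ (k - 1) ⋯ σ 0 * a * σ 0 ⋯ σ (k - 1)`. -/
def pal : ℕ → P
  | 0 => a
  | k + 1 => σ k * pal k * σ k

/-- The element `pal 0 * ⋯ * pal (k - 1)`. -/
def palProd : ℕ → P
  | 0 => 1
  | k + 1 => palProd k * pal a σ k

/-- The element `a * σ 0 ⋯ σ (k - 1)`. -/
def asc : ℕ → P
  | 0 => a
  | k + 1 => asc k * σ k

/-- The product of `σ k`, `σ (k - 1)`, ..., with `j` factors. -/
def desc (k : ℕ) : ℕ → P
  | 0 => 1
  | j + 1 => desc k j * σ (k - j)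

theorem desc_succ_succ (k j : ℕ) : desc σ (k + 1) (j + 1) = σ (k + 1) * desc σ k j := by
  induction j with
  | zero => simp [desc]
  | succ j ih => rw [desc, ih, desc, Nat.add_sub_add_right, mul_assoc]

theorem desc_mul_asc (k : ℕ) : desc σ k (k + 1) * asc a σ (k + 1) = pal a σ (k + 1) := by
  induction k with
  | zero => simp [desc, asc, pal, mul_assoc]
  | succ k ih => rw [desc_succ_succ, asc, pal, ← ih]; simp only [mul_assoc]

end garside

/-- The defining relations of the monoid generated by `M` and `m` braid letters. -/
structure BraidRelations {M : Type*} [Monoid M] {h : M} (d : GarsideData M h) {P : Type*} [Monoid P]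
    (m : ℕ) (f : M →* P) (σ : ℕ → P) : Prop where
  comm : ∀ i j, i + 2 ≤ j → j < m → Commute (σ i) (σ j)
  braid : ∀ i, i + 1 < m → σ i * σ (i + 1) * σ i = σ (i + 1) * σ i * σ (i + 1)
  comm_f : ∀ y i, i ≠ 0 → i < m → Commute (f y) (σ i)
  f_mul : ∀ y, 0 < m → f y * (σ 0 * f h * σ 0) = σ 0 * f h * σ 0 * f (d.τ y)

namespace BraidRelations

variable {M : Type*} [Monoid M] {h : M} {d : GarsideData M h} {P : Type*} [Monoid P]
    {m : ℕ} {f : M →* P} {σ : ℕ → P} (B : BraidRelations d m f σ)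
include B

theorem f_mul_pal (y : M) {k : ℕ} (hk : k ≤ m) :
    f y * pal (f h) σ k = pal (f h) σ k * f (d.τ y) := by
  induction k generalizing y with
  | zero => rw [pal, ← map_mul, ← map_mul, d.mul_h]
  | succ k ih =>
    rcases Nat.eq_zero_or_pos k with rfl | h0
    · exact B.f_mul y hk
    · rw [pal, mul_assoc, (B.comm_f _ k h0.ne' hk).left_comm, ← mul_assoc (f y), ih _ (by omega),
        mul_assoc, mul_assoc, mul_assoc, (B.comm_f _ k h0.ne' hk).eq]

theorem f_mul_palProd (y : M) {k : ℕ} (hk : k ≤ m + 1) :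
    f y * palProd (f h) σ k = palProd (f h) σ k * f (((d.τ : MulAut M) ^ k) y) := by
  induction k generalizing y with
  | zero => simp [palProd]
  | succ k ih =>
    rw [palProd, ← mul_assoc, ih _ (by omega), mul_assoc, B.f_mul_pal _ (by omega), ← mul_assoc,
      pow_succ', MulAut.mul_apply]

theorem commute_pal {i k : ℕ} (hi : i < m) (hk : k ≤ m) (h1 : i ≠ k) (h2 : i + 1 ≠ k) :
    Commute (σ i) (pal (f h) σ k) := by
  induction k with
  | zero => exact (B.comm_f h i h1 hi).symm
  | succ k ih =>
    by_cases h3 : i + 1 = k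
    · subst h3
      have hb := B.braid i hk
      have h4 : Commute (σ (i + 1)) (pal (f h) σ i) := by
        clear ih
        have key : ∀ j ≤ i, Commute (σ (i + 1)) (pal (f h) σ j) := by
          intro j hj
          induction j with
          | zero => exact (B.comm_f h (i + 1) (by omega) (by omega)).symm
          | succ j ihj =>
            have hc := (B.comm j (i + 1) (by omega) (by omega)).symm
            exact (hc.mul_right (ihj (by omega))).mul_right hc
        exact key i le_rfl
      change σ i * (σ (i + 1) * (σ i * pal (f h) σ i * σ i) * σ (i + 1)) =
        σ (i + 1) * (σ i * pal (f h) σ i * σ i) * σ (i + 1) * σ i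
      calc _ = σ i * σ (i + 1) * σ i * pal (f h) σ i * σ i * σ (i + 1) := by
            simp only [mul_assoc]
        _ = σ (i + 1) * σ i * (σ (i + 1) * pal (f h) σ i) * σ i * σ (i + 1) := by
            rw [hb]; simp only [mul_assoc]
        _ = σ (i + 1) * σ i * pal (f h) σ i * (σ (i + 1) * σ i * σ (i + 1)) := by
            rw [h4.eq]; simp only [mul_assoc]
        _ = _ := by rw [← hb]; simp only [mul_assoc]
    · have hc : Commute (σ i) (σ k) := by
        rcases lt_trichotomy i k with h5 | h5 | h5
        · exact B.comm i k (by omega) (by omega)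
        · omega
        · exact (B.comm k i (by omega) hi).symm
      exact (hc.mul_right (ih (by omega) (by omega) h3)).mul_right hc

theorem commute_pal_pal {j k : ℕ} (hk : k ≤ m) (hjk : j < k) :
    Commute (pal (f h) σ j) (pal (f h) σ k) := by
  induction j with
  | zero =>
    have := B.f_mul_pal h hk
    rwa [d.τ_h] at this
  | succ j ih =>
    have hc := B.commute_pal (i := j) (by omega) hk (by omega) (by omega)
    exact (hc.mul_left (ih (by omega))).mul_left hc

theorem commute_palProd_pal {j k : ℕ} (hk : k ≤ m) (hjk : j ≤ k) :
    Commute (palProd (f h) σ j) (pal (f h) σ k) := by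
  induction j with
  | zero => exact Commute.one_left _
  | succ j ih => exact (ih (by omega)).mul_left (B.commute_pal_pal hk (by omega))

theorem commute_palProd {i k : ℕ} (hi : i < m) (hk : k ≤ m + 1) (h2 : i + 1 ≠ k) :
    Commute (σ i) (palProd (f h) σ k) := by
  induction k using Nat.strong_induction_on with
  | _ k ih =>
    rcases k with _ | k
    · exact Commute.one_right _
    by_cases h3 : i + 1 = k
    · subst h3
      rw [palProd, palProd, mul_assoc]
      refine (ih i (by omega) (by omega) (by omega)).mul_right ?_
      have hc := B.commute_pal_pal (j := i) (k := i + 1) (by omega) (by omega)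
      calc σ i * (pal (f h) σ i * pal (f h) σ (i + 1))
          = pal (f h) σ (i + 1) * pal (f h) σ i * σ i := by
            simp only [pal, mul_assoc]
        _ = _ := by rw [← hc.eq]
    · exact (ih k (by omega) (by omega) h3).mul_right
        (B.commute_pal hi (by omega) (by omega) h3)

theorem commute_asc {i k : ℕ} (hi : i < m) (h1 : k < i) : Commute (σ i) (asc (f h) σ k) := by
  induction k with
  | zero => exact (B.comm_f h i (by omega) hi).symm
  | succ k ih => exact (ih (by omega)).mul_right (B.comm k i (by omega) hi).symm

theorem mul_asc {i k : ℕ} (hk : k ≤ m) (h1 : i + 1 < k) :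
    σ (i + 1) * asc (f h) σ k = asc (f h) σ k * σ i := by
  induction k with
  | zero => omega
  | succ k ih =>
    by_cases h2 : i + 1 = k
    · subst h2
      have h3 := B.commute_asc (i := i + 1) (k := i) (by omega) (by omega)
      rw [asc, asc, mul_assoc, h3.left_comm, ← mul_assoc (σ (i + 1)), ← B.braid i (by omega)]
      simp only [mul_assoc]
    · rw [asc, ← mul_assoc, ih (by omega) (by omega), mul_assoc, mul_assoc,
        (B.comm i k (by omega) (by omega)).eq]

theorem desc_mul_asc_succ {k j : ℕ} (hk : k + 1 ≤ m) (hj : j ≤ k) :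
    desc σ k j * asc (f h) σ (k + 1) = asc (f h) σ k * desc σ k (j + 1) := by
  induction j with
  | zero => simp [desc, asc]
  | succ j ih =>
    have h1 : k - j = (k - (j + 1)) + 1 := by omega
    rw [desc, mul_assoc, h1, B.mul_asc hk (by omega), ← mul_assoc, ih (by omega), mul_assoc]
    rfl

theorem asc_pow {k j : ℕ} (hk : k + 1 ≤ m) (hj : j ≤ k + 1) :
    asc (f h) σ (k + 1) ^ j = asc (f h) σ k ^ j * desc σ k j := by
  induction j with
  | zero => simp [desc]
  | succ j ih =>
    rw [pow_succ, ih (by omega), mul_assoc, B.desc_mul_asc_succ hk (by omega), ← mul_assoc,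
      ← pow_succ]

theorem asc_pow_eq_palProd {k : ℕ} (hk : k ≤ m) :
    asc (f h) σ k ^ (k + 1) = palProd (f h) σ (k + 1) := by
  induction k with
  | zero => simp [asc, palProd, pal]
  | succ k ih =>
    rw [pow_succ, B.asc_pow hk le_rfl, ih (by omega), mul_assoc, desc_mul_asc]
    rfl

theorem pal_leftDvd_palProd {j k : ℕ} (hk : k ≤ m + 1) (hj : j < k) :
    leftDvd (pal (f h) σ j) (palProd (f h) σ k) := by
  induction k with
  | zero => omega
  | succ k ih =>
    by_cases h1 : j = k
    · subst h1
      exact ⟨palProd (f h) σ j, (B.commute_palProd_pal (by omega) le_rfl).eq.symm⟩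
    · obtain ⟨c, hc⟩ := ih (by omega) (by omega)
      exact ⟨c * pal (f h) σ k, by rw [← mul_assoc, hc]; rfl⟩

end BraidRelations

/-- A finite family extended by `1` to all natural numbers. -/
def Fin.extendOne {P : Type*} [One P] {m : ℕ} (g : Fin m → P) (k : ℕ) : P :=
  if hk : k < m then g ⟨k, hk⟩ else 1

theorem Fin.extendOne_val {P : Type*} [One P] {m : ℕ} (g : Fin m → P) (i : Fin m) :
    Fin.extendOne g i = g i := dif_pos i.2

namespace GarsideData

open Complemented FreeMonoid

variable {M : Type*} [Monoid M] {h : M} (d : GarsideData M h) {m : ℕ}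

theorem braidRelations_of_fin {P : Type*} [Monoid P] (f : M →* P) (g : Fin m → P)
    (hcomm : ∀ i j : Fin m, i.val + 2 ≤ j.val → g i * g j = g j * g i)
    (hbraid : ∀ i j : Fin m, i.val + 1 = j.val → g i * g j * g i = g j * g i * g j)
    (hf : ∀ y (i : Fin m), i.val ≠ 0 → f y * g i = g i * f y)
    (hfh : ∀ y (i : Fin m), i.val = 0 →
      f y * (g i * f h * g i) = g i * f h * g i * f (d.τ y)) :
    BraidRelations d m f (Fin.extendOne g) := by
  constructor
  · intro i j hij hj
    have := hcomm ⟨i, by omega⟩ ⟨j, hj⟩ hij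
    rwa [← Fin.extendOne_val g, ← Fin.extendOne_val g] at this
  · intro i hi
    have := hbraid ⟨i, by omega⟩ ⟨i + 1, hi⟩ rfl
    rwa [← Fin.extendOne_val g, ← Fin.extendOne_val g] at this
  · intro y i h0 hi
    have := hf y ⟨i, hi⟩ h0
    rwa [← Fin.extendOne_val g] at this
  · intro y hm
    have := hfh y ⟨0, hm⟩ rfl
    rwa [← Fin.extendOne_val g] at this

theorem braidRelations (m : ℕ) : BraidRelations d m (d.ι m) (Fin.extendOne d.s) :=
  d.braidRelations_of_fin _ _ (fun _ _ => d.s_mul_s) (fun _ _ => d.braid)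
    (fun y _ hi => d.ι_mul_s y hi) (fun y _ hi => d.ι_mul_shs y hi)

/-- The endomorphism of `N` induced by an endomorphism of `M`. -/
noncomputable def mapHom (m : ℕ) (α : M →* M) (h1 : α h = h)
    (h2 : ∀ y, α (d.τ y) = d.τ (α y)) : d.N m →* d.N m :=
  d.lift ((d.ι m).comp α) d.s (fun _ _ => d.s_mul_s) (fun _ _ => d.braid)
    (fun y _ hi => d.ι_mul_s _ hi) (fun y _ hi => by
      simpa only [MonoidHom.comp_apply, h1, h2] using d.ι_mul_shs _ hi)

/-- The automorphism of `N` induced by an automorphism of `M`. -/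
noncomputable def mapEquiv (m : ℕ) (α : M ≃* M) (h1 : α h = h)
    (h2 : ∀ y, α (d.τ y) = d.τ (α y)) : d.N m ≃* d.N m :=
  MonoidHom.toMulEquiv (d.mapHom m α h1 h2)
    (d.mapHom m α.symm (by simpa using (α.symm_apply_eq.2 h1.symm)) (fun y => by
      simpa using (α.symm_apply_eq.2 (by simp [h2]))))
    (d.hom_ext (by simp [mapHom]) (by simp [mapHom]))
    (d.hom_ext (by simp [mapHom]) (by simp [mapHom]))

/-- The Garside element of `N`. -/
noncomputable def Δ (m : ℕ) : d.N m := palProd (d.ι m h) (Fin.extendOne d.s) (m + 1)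

theorem exists_mulEquiv_Δ (m : ℕ) : ∃ Φ : d.N m ≃* d.N m, ∀ x, x * d.Δ m = d.Δ m * Φ x := by
  have B := d.braidRelations m
  have h1 : ∀ k, ((d.τ : MulAut M) ^ k) h = h := by
    intro k
    induction k with
    | zero => rfl
    | succ k ih => rw [pow_succ, MulAut.mul_apply, d.τ_h, ih]
  have h2 : ∀ k y, ((d.τ : MulAut M) ^ k) (d.τ y) = d.τ (((d.τ : MulAut M) ^ k) y) := by
    intro k y
    rw [← MulAut.mul_apply, ← MulAut.mul_apply, ← pow_succ, ← pow_succ']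
  refine ⟨d.mapEquiv m ((d.τ : MulAut M) ^ (m + 1)) (h1 _) (h2 _), fun x => ?_⟩
  have hx : x ∈ Submonoid.closure (Set.range (d.ι m) ∪ Set.range d.s) :=
    d.closure_eq_top ▸ Submonoid.mem_top x
  induction hx using Submonoid.closure_induction with
  | mem x hx =>
    rcases hx with ⟨y, rfl⟩ | ⟨i, rfl⟩
    · refine (B.f_mul_palProd y le_rfl).trans ?_
      simp [mapEquiv, mapHom, Δ]
    · have := B.commute_palProd (i := i) (k := m + 1) i.2 le_rfl (by omega)
      rw [Fin.extendOne_val] at this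
      refine this.eq.trans ?_
      simp [mapEquiv, mapHom, Δ]
  | one => simp
  | mul x y _ _ hx hy => rw [mul_assoc, hy, ← mul_assoc, hx, map_mul, mul_assoc]

theorem leftDvd_trans {P : Type*} [Monoid P] {a b c : P} (h1 : leftDvd a b) (h2 : leftDvd b c) :
    leftDvd a c := by
  obtain ⟨x, rfl⟩ := h1
  obtain ⟨y, rfl⟩ := h2
  exact ⟨x * y, (mul_assoc _ _ _).symm⟩

theorem closure_leftDvd_Δ (hgen : Submonoid.closure {x : M | leftDvd x h} = ⊤) :
    Submonoid.closure {x : d.N m | leftDvd x (d.Δ m)} = ⊤ := by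
  have B := d.braidRelations m
  rw [eq_top_iff, ← closure_eq_top, Submonoid.closure_le]
  rintro _ (⟨y, rfl⟩ | ⟨i, rfl⟩)
  · have hy : y ∈ Submonoid.closure {x : M | leftDvd x h} := hgen ▸ Submonoid.mem_top y
    have h1 : Submonoid.closure {x : M | leftDvd x h} ≤
        (Submonoid.closure {x : d.N m | leftDvd x (d.Δ m)}).comap (d.ι m) := by
      refine Submonoid.closure_le.2 ?_
      rintro z ⟨c, hc⟩
      refine Submonoid.subset_closure (leftDvd_trans ⟨d.ι m c, ?_⟩
        (B.pal_leftDvd_palProd le_rfl (Nat.succ_pos m)))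
      rw [← map_mul, hc]
      rfl
    exact h1 hy
  · refine Submonoid.subset_closure (leftDvd_trans ?_
      (B.pal_leftDvd_palProd (j := i + 1) le_rfl (by omega)))
    rw [pal, Fin.extendOne_val, mul_assoc]
    exact ⟨_, rfl⟩

theorem mul_left_cancel (a x y : d.N m) (he : a * x = a * y) : x = y :=
  mul_left_cancel_of_reduces (reduces d m) a x y he

/-- The monoid generated by a Garside monoid and braid letters is a Garside monoid. -/
theorem isGarside (H : IsGarside M h) (m : ℕ) : IsGarside (d.N m) (d.Δ m) := by
  obtain ⟨⟨T, hT⟩, -, -, -, -, -, -, -, -, -, hgen, -⟩ := H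
  obtain ⟨Φ, hΦ⟩ := d.exists_mulEquiv_Δ m
  refine isGarside_of_left ?_ ⟨d.norm, d.norm_eq_zero, d.norm_mul⟩ d.mul_left_cancel
    (exists_lcm_of_reduces d.norm d.norm_mul d.norm_gen_pos (reduces d m)) hΦ
    (d.closure_leftDvd_Δ hgen)
  classical
  refine ⟨T.image (d.ι m) ∪ Finset.univ.image d.s, ?_⟩
  rw [eq_top_iff, ← closure_eq_top, Submonoid.closure_le]
  rintro _ (⟨y, rfl⟩ | ⟨i, rfl⟩)
  · have h1 : Submonoid.closure (T : Set M) ≤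
        (Submonoid.closure (↑(T.image (d.ι m) ∪ Finset.univ.image d.s) : Set (d.N m))).comap
          (d.ι m) :=
      Submonoid.closure_le.2 fun z hz => Submonoid.subset_closure (by
        simp only [Finset.coe_union, Finset.coe_image]
        exact Or.inl ⟨z, hz, rfl⟩)
    exact h1 (hT ▸ Submonoid.mem_top y)
  · exact Submonoid.subset_closure (by simp)

end GarsideData

/-! ### Embedding in groups -/

/-- An Ore monoid embeds in a group. -/
theorem exists_injective_hom_group {N : Type} [Monoid N]
    (hl : ∀ a b c : N, a * b = a * c → b = c) (hr : ∀ a b c : N, b * a = c * a → b = c)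
    (hm : ∀ a b : N, ∃ x y, x * a = y * b) :
    ∃ (F : Type) (_ : Group F) (j : N →* F), Function.Injective j := by
  choose x y hxy using hm
  let _ : OreLocalization.OreSet (⊤ : Submonoid N) :=
    { ore_right_cancel := fun r₁ r₂ s hs => ⟨1, by rw [hr _ _ _ hs]⟩
      oreNum := fun r s => y r s
      oreDenom := fun r s => ⟨x r s, trivial⟩
      ore_eq := fun r s => hxy r s }
  refine ⟨(OreLocalization (⊤ : Submonoid N) N)ˣ, inferInstance,
    Units.liftRight (OreLocalization.numeratorHom (S := (⊤ : Submonoid N)) (R := N))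
      (fun r => OreLocalization.numeratorUnit ⟨r, trivial⟩) (fun r => rfl), fun a b hab => ?_⟩
  have h1 : OreLocalization.numeratorHom (S := (⊤ : Submonoid N)) a =
      OreLocalization.numeratorHom (S := (⊤ : Submonoid N)) b := congrArg Units.val hab
  rw [OreLocalization.numeratorHom_apply, OreLocalization.numeratorHom_apply,
    OreLocalization.oreDiv_eq_iff] at h1
  obtain ⟨u, v, h2, h3⟩ := h1
  simp only [OneMemClass.coe_one, mul_one, Submonoid.smul_def, smul_eq_mul] at h2 h3
  rw [h3] at h2
  exact (hl _ _ _ h2).symm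

section fractions

variable {H : Type*} [Group H] {M : Submonoid H}
  (hfrac : ∀ g : H, ∃ a b : M, g = (a : H)⁻¹ * (b : H)) {F : Type*} [Group F]
include hfrac

theorem hom_ext_of_fractions {f g : H →* F} (hfg : ∀ y : M, f y = g y) : f = g := by
  ext y
  obtain ⟨a, b, rfl⟩ := hfrac y
  simp [hfg]

/-- Homomorphisms to groups extend to the group of fractions. -/
theorem exists_extension_of_fractions (f : M →* F) : ∃ g : H →* F, ∀ y : M, g y = f y := by
  have hw : ∀ a b c e : M, (a : H)⁻¹ * b = (c : H)⁻¹ * e → (f a)⁻¹ * f b = (f c)⁻¹ * f e := by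
    intro a b c e he
    obtain ⟨p, q, hpq⟩ := hfrac ((c : H) * (a : H)⁻¹)
    have h1 : p * c = q * a := by
      refine Subtype.ext ?_
      rw [mul_inv_eq_iff_eq_mul, mul_assoc, eq_inv_mul_iff_mul_eq] at hpq
      exact hpq
    have h2 : p * e = q * b := by
      refine Subtype.ext ?_
      rw [eq_inv_mul_iff_mul_eq, ← mul_assoc, hpq, mul_assoc, inv_mul_eq_iff_eq_mul] at he
      exact he.symm
    have h1' := congrArg f h1
    have h2' := congrArg f h2
    rw [map_mul, map_mul] at h1' h2'
    rw [eq_inv_mul_of_mul_eq h1', eq_inv_mul_of_mul_eq h2']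
    group
  choose num den hnd using hfrac
  have hv : ∀ a b : M, (f (num ((a : H)⁻¹ * b)))⁻¹ * f (den ((a : H)⁻¹ * b)) = (f a)⁻¹ * f b :=
    fun a b => hw _ _ _ _ (hnd _).symm
  refine ⟨MonoidHom.mk' (fun g => (f (num g))⁻¹ * f (den g)) fun g g' => ?_, fun y => ?_⟩
  · have h1 := hnd ((den g : H) * (num g' : H)⁻¹)
    set p := num ((den g : H) * (num g' : H)⁻¹)
    set q := den ((den g : H) * (num g' : H)⁻¹)
    have h2 : p * den g = q * num g' := by
      refine Subtype.ext ?_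
      rw [mul_inv_eq_iff_eq_mul, mul_assoc, eq_inv_mul_iff_mul_eq] at h1
      exact h1
    have h3 : g * g' = ((p * num g : M) : H)⁻¹ * ((q * den g' : M) : H) := by
      rw [Submonoid.coe_mul, Submonoid.coe_mul]
      calc g * g' = ((num g : H)⁻¹ * den g) * ((num g' : H)⁻¹ * den g') :=
            congrArg₂ (· * ·) (hnd g) (hnd g')
        _ = ((num g : H))⁻¹ * ((den g : H) * (num g' : H)⁻¹) * den g' := by group
        _ = _ := by rw [h1]; group
    have h2' := congrArg f h2
    rw [map_mul, map_mul] at h2'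
    rw [h3, hv, map_mul, map_mul, eq_inv_mul_of_mul_eq h2']
    group
  · have := hv 1 y
    simpa using this

end fractions

/-! ### The Artin type representation of a group satisfying the braid relations -/

section artin

variable {H : Type} {F : Type*} [Group H] [Group F] (h : H) (f : H →* F) (σ : ℕ → F)

/-- The images of the embeddings of the free factors. -/
def artinHom : ℕ → H →* F
  | 0 => f
  | k + 1 => ((MulAut.conj (σ k)⁻¹).toMonoidHom.comp (artinHom k)).comp
      (MulAut.conj h).toMonoidHom

theorem artinHom_succ (k : ℕ) (y : H) :
    artinHom h f σ (k + 1) y = (σ k)⁻¹ * artinHom h f σ k (h * y * h⁻¹) * σ k := by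
  simp [artinHom]

variable {h f σ} {m : ℕ} (hcomm : ∀ i j, i + 2 ≤ j → j < m → Commute (σ i) (σ j))
  (hbraid : ∀ i, i + 1 < m → σ i * σ (i + 1) * σ i = σ (i + 1) * σ i * σ (i + 1))
  (hf : ∀ y i, i ≠ 0 → i < m → Commute (f y) (σ i))

include hcomm hbraid hf in
theorem commute_artinHom {j k : ℕ} (hj : j ≤ m) (hk : k < m) (h1 : j ≠ k) (h2 : j ≠ k + 1)
    (y : H) : Commute (artinHom h f σ j y) (σ k) := by
  induction j using Nat.strong_induction_on generalizing k y with
  | _ j ih =>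
    rcases j with _ | j
    · exact hf y k h1.symm hk
    rw [artinHom_succ]
    by_cases h3 : j = k + 1
    · subst h3
      have hc := ih k (by omega) (k := k + 1) (by omega) (by omega) (by omega) (by omega)
        (h * (h * y * h⁻¹) * h⁻¹)
      have hb := hbraid k (by omega)
      rw [artinHom_succ]
      generalize artinHom h f σ k (h * (h * y * h⁻¹) * h⁻¹) = u at hc
      have h4 : (σ (k + 1))⁻¹ * ((σ k)⁻¹ * u * σ k) * σ (k + 1) =
          (σ k * σ (k + 1))⁻¹ * u * (σ k * σ (k + 1)) := by group
      have h5 : σ k = (σ k * σ (k + 1))⁻¹ * σ (k + 1) * (σ k * σ (k + 1)) := by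
        rw [mul_assoc, ← mul_assoc (σ (k + 1)), ← hb]; group
      rw [h4]
      have h6 := (hc.map (MulAut.conj (σ k * σ (k + 1))⁻¹))
      rwa [MulAut.conj_apply, MulAut.conj_apply, inv_inv, ← h5] at h6
    · have hc : Commute (σ j) (σ k) := by
        rcases lt_or_gt_of_ne (show j ≠ k by omega) with h5 | h5
        · exact hcomm j k (by omega) hk
        · exact (hcomm k j (by omega) (by omega)).symm
      exact (hc.inv_left.mul_left (ih j (by omega) (by omega) hk (by omega) (by omega) _)).mul_left
        hc

variable (hfh : ∀ y, 0 < m → f y * (σ 0 * f h * σ 0) = σ 0 * f h * σ 0 * f (h⁻¹ * y * h))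

include hcomm hbraid hf hfh in
theorem artinHom_mul {k : ℕ} (hk : k < m) (y : H) :
    artinHom h f σ k y * (σ k * artinHom h f σ k h * σ k) =
      σ k * artinHom h f σ k h * σ k * artinHom h f σ k (h⁻¹ * y * h) := by
  induction k generalizing y with
  | zero => exact hfh y hk
  | succ k ih =>
    have hc := commute_artinHom (h := h) hcomm hbraid hf (j := k) (k := k + 1) (by omega) hk
      (by omega) (by omega)
    have hb := hbraid k hk
    have h1 := ih (by omega) (h * y * h⁻¹)
    have h3 : h⁻¹ * (h * y * h⁻¹) * h = y := by group
    have h4 : h * (h⁻¹ * y * h) * h⁻¹ = y := by group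
    have h5 : h * h * h⁻¹ = h := by group
    rw [h3] at h1
    simp only [artinHom_succ, h4, h5]
    have hu := hc (h * y * h⁻¹)
    have hv := hc h
    have hw := hc y
    generalize artinHom h f σ k (h * y * h⁻¹) = u at *
    generalize artinHom h f σ k h = v at *
    generalize artinHom h f σ k y = w at *
    generalize σ (k + 1) = b at *
    generalize σ k = a at *
    have h6 : a * b * a⁻¹ = b⁻¹ * a * b := by
      rw [mul_inv_eq_iff_eq_mul, mul_assoc, mul_assoc, eq_inv_mul_iff_mul_eq, ← mul_assoc,
        ← mul_assoc]
      exact hb.symm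
    have h7 : b * a⁻¹ * b⁻¹ = a⁻¹ * b⁻¹ * a := by
      rw [mul_inv_eq_iff_eq_mul, mul_assoc, mul_assoc, eq_inv_mul_iff_mul_eq]
      simpa only [mul_assoc] using h6
    calc a⁻¹ * u * a * (b * (a⁻¹ * v * a) * b)
        = a⁻¹ * u * (a * b * a⁻¹) * v * a * b := by group
      _ = a⁻¹ * (u * b⁻¹) * a * (b * v) * a * b := by rw [h6]; group
      _ = a⁻¹ * b⁻¹ * u * a * v * (b * a * b) := by rw [hu.inv_right.eq, ← hv.eq]; group
      _ = a⁻¹ * b⁻¹ * (u * (a * v * a)) * b * a := by rw [← hb]; group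
      _ = a⁻¹ * b⁻¹ * (a * v * a) * (w * b) * a := by rw [h1]; group
      _ = (a⁻¹ * b⁻¹ * a) * v * a * b * w * a := by rw [hw.eq]; group
      _ = b * a⁻¹ * (b⁻¹ * v) * a * b * w * a := by rw [← h7]; group
      _ = b * a⁻¹ * v * (b⁻¹ * a * b) * w * a := by rw [← hv.inv_right.eq]; group
      _ = _ := by rw [← h6]; group

include hcomm hbraid hf hfh in
theorem conj_artinHom {k : ℕ} (hk : k < m) (y : H) :
    σ k * artinHom h f σ k y * (σ k)⁻¹ =
      (artinHom h f σ k h)⁻¹ * artinHom h f σ (k + 1) y * artinHom h f σ k h := by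
  have h1 := artinHom_mul hcomm hbraid hf hfh hk (h * y * h⁻¹)
  have h3 : h⁻¹ * (h * y * h⁻¹) * h = y := by group
  rw [h3] at h1
  rw [artinHom_succ, mul_inv_eq_iff_eq_mul]
  calc σ k * artinHom h f σ k y
      = (artinHom h f σ k h)⁻¹ * (σ k)⁻¹ *
          (σ k * artinHom h f σ k h * σ k * artinHom h f σ k y) := by group
    _ = _ := by rw [← h1]; group

theorem conj_artinHom_succ (k : ℕ) (y : H) :
    σ k * artinHom h f σ (k + 1) y * (σ k)⁻¹ =
      artinHom h f σ k h * artinHom h f σ k y * (artinHom h f σ k h)⁻¹ := by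
  rw [artinHom_succ, map_mul, map_mul, map_inv]
  group

include hcomm hbraid hf hfh in
/-- Homomorphisms out of the semidirect product with the braid group. -/
theorem exists_hom_semidirect {n : ℕ} (hn : n - 1 = m) (hn1 : 2 ≤ n)
    {ρ : BraidGroup (n - 1) →* MulAut (Monoid.CoprodI (fun _ : Fin n => H))}
    (hρ : IsArtinRep h ρ) :
    ∃ ψ : Monoid.CoprodI (fun _ : Fin n => H) ⋊[ρ] BraidGroup (n - 1) →* F,
      (∀ y, ψ (SemidirectProduct.inl (Monoid.CoprodI.of (i := (⟨0, by omega⟩ : Fin n)) y)) = f y) ∧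
      ∀ i : Fin (n - 1), ψ (SemidirectProduct.inr (braidGen i)) = σ i := by
  have hrel : ∀ r ∈ braidRels (n - 1), FreeGroup.lift (fun i : Fin (n - 1) => σ i) r = 1 := by
    rintro r (⟨i, j, hij, rfl⟩ | ⟨i, j, hij, rfl⟩)
    · simp only [map_mul, map_inv, FreeGroup.lift_apply_of]
      rw [mul_inv_eq_one, ← hij]
      exact hbraid i (by omega)
    · simp only [map_mul, map_inv, FreeGroup.lift_apply_of]
      rw [mul_inv_eq_one]
      exact hcomm i j hij (by omega)
  let fg : BraidGroup (n - 1) →* F := PresentedGroup.toGroup hrel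
  have hfg : ∀ i, fg (braidGen i) = σ i := fun i => PresentedGroup.toGroup.of hrel
  let fn : Monoid.CoprodI (fun _ : Fin n => H) →* F :=
    Monoid.CoprodI.lift fun k : Fin n => artinHom h f σ k
  have hfn : ∀ (k : Fin n) y, fn (Monoid.CoprodI.of (i := k) y) = artinHom h f σ k y :=
    fun k y => Monoid.CoprodI.lift_of (fun k : Fin n => artinHom h f σ k) y
  have hconj : ∀ g : BraidGroup (n - 1), ∀ x, fn (ρ g x) = fg g * fn x * (fg g)⁻¹ := by
    intro g
    have hg : g ∈ Subgroup.closure (Set.range (PresentedGroup.of (rels := braidRels (n - 1)))) := by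
      rw [PresentedGroup.closure_range_of]
      exact Subgroup.mem_top g
    induction hg using Subgroup.closure_induction with
    | mem g hg =>
      obtain ⟨k, rfl⟩ := hg
      have hkm : (k : ℕ) < m := by omega
      have key : fn.comp (ρ (braidGen k)).toMonoidHom =
          (MulAut.conj (fg (braidGen k))).toMonoidHom.comp fn := by
        refine Monoid.CoprodI.ext_hom _ _ fun j => MonoidHom.ext fun y => ?_
        change fn (ρ (braidGen k) (Monoid.CoprodI.of (i := j) y)) =
          fg (braidGen k) * fn (Monoid.CoprodI.of (i := j) y) * (fg (braidGen k))⁻¹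
        obtain ⟨r1, r2, r3⟩ := hρ k
        rw [hfg]
        by_cases h0 : j = idx0 k
        · subst h0
          rw [r1]
          simp only [map_mul, map_inv, hfn]
          exact (conj_artinHom hcomm hbraid hf hfh hkm y).symm
        by_cases h1 : j = idx1 k
        · subst h1
          rw [r2]
          simp only [map_mul, map_inv, hfn]
          exact (conj_artinHom_succ k y).symm
        · rw [r3 j h0 h1, hfn, eq_mul_inv_iff_mul_eq]
          exact commute_artinHom hcomm hbraid hf (by omega) hkm (fun h => h0 (Fin.ext h))
            (fun h => h1 (Fin.ext h)) y
      exact fun x => DFunLike.congr_fun key x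
    | one => simp
    | mul a b _ _ ha hb => intro x; simp [ha, hb, mul_assoc]
    | inv a _ ha =>
      intro x
      have := ha ((ρ a)⁻¹ x)
      rw [MulAut.apply_inv_self] at this
      rw [map_inv, this, map_inv]
      group
  refine ⟨SemidirectProduct.lift fn fg fun g => MonoidHom.ext fun x => hconj g x, fun y => ?_,
    fun i => ?_⟩
  · rw [SemidirectProduct.lift_inl, hfn]
    rfl
  · rw [SemidirectProduct.lift_inr, hfg]

end artin

/-! ### The main theorem -/

section relations

variable {n : ℕ} (hn : 2 ≤ n) {H : Type} [Group H] {h : H}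
    {ρ : BraidGroup (n - 1) →* MulAut (Monoid.CoprodI (fun _ : Fin n => H))}

theorem braidGen_commute {m : ℕ} (i j : Fin m) (hij : i.val + 2 ≤ j.val) :
    braidGen i * braidGen j = braidGen j * braidGen i := by
  have h1 := PresentedGroup.one_of_mem (rels := braidRels m) (Or.inr ⟨i, j, hij, rfl⟩)
  rwa [map_mul, map_inv, mul_inv_eq_one, map_mul, map_mul] at h1

theorem braidGen_braid {m : ℕ} (i j : Fin m) (hij : i.val + 1 = j.val) :
    braidGen i * braidGen j * braidGen i = braidGen j * braidGen i * braidGen j := by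
  have h1 := PresentedGroup.one_of_mem (rels := braidRels m) (Or.inl ⟨i, j, hij, rfl⟩)
  rwa [map_mul, map_inv, mul_inv_eq_one, map_mul, map_mul, map_mul, map_mul] at h1

theorem inr_mul_inl {N G : Type*} [Group N] [Group G] {φ : G →* MulAut N} (g : G) (x : N) :
    (SemidirectProduct.inr g * SemidirectProduct.inl x : N ⋊[φ] G) =
      SemidirectProduct.inl (φ g x) * SemidirectProduct.inr g := by
  rw [SemidirectProduct.inl_aut, map_inv]
  group

theorem IsArtinRep.inl_mul_inr (hρ : IsArtinRep h ρ) (y : H) (i : Fin (n - 1)) (hi : i.val ≠ 0) :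
    (SemidirectProduct.inl (Monoid.CoprodI.of (i := (⟨0, by omega⟩ : Fin n)) y) *
        SemidirectProduct.inr (braidGen i) : _ ⋊[ρ] _) =
      SemidirectProduct.inr (braidGen i) *
        SemidirectProduct.inl (Monoid.CoprodI.of (i := (⟨0, by omega⟩ : Fin n)) y) := by
  rw [inr_mul_inl, (hρ i).2.2]
  · exact fun h => hi (Fin.ext_iff.1 h).symm
  · exact fun h => by simp [idx1] at h

theorem IsArtinRep.inl_mul (hρ : IsArtinRep h ρ) (y : H) (i : Fin (n - 1)) (hi : i.val = 0) :
    (SemidirectProduct.inl (Monoid.CoprodI.of (i := (⟨0, by omega⟩ : Fin n)) y) *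
        (SemidirectProduct.inr (braidGen i) *
          SemidirectProduct.inl (Monoid.CoprodI.of (i := (⟨0, by omega⟩ : Fin n)) h) *
          SemidirectProduct.inr (braidGen i)) : _ ⋊[ρ] _) =
      SemidirectProduct.inr (braidGen i) *
          SemidirectProduct.inl (Monoid.CoprodI.of (i := (⟨0, by omega⟩ : Fin n)) h) *
          SemidirectProduct.inr (braidGen i) *
        SemidirectProduct.inl (Monoid.CoprodI.of (i := (⟨0, by omega⟩ : Fin n))
          (h⁻¹ * y * h)) := by
  have hp : 0 < n - 1 := by omega
  obtain rfl : i = ⟨0, hp⟩ := Fin.ext hi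
  let S : Monoid.CoprodI (fun _ : Fin n => H) ⋊[ρ] BraidGroup (n - 1) :=
    SemidirectProduct.inr (braidGen ⟨0, hp⟩)
  let A : H →* Monoid.CoprodI (fun _ : Fin n => H) ⋊[ρ] BraidGroup (n - 1) :=
    SemidirectProduct.inl.comp (Monoid.CoprodI.of (M := fun _ : Fin n => H) (i := ⟨0, by omega⟩))
  let X : H →* Monoid.CoprodI (fun _ : Fin n => H) ⋊[ρ] BraidGroup (n - 1) :=
    SemidirectProduct.inl.comp (Monoid.CoprodI.of (M := fun _ : Fin n => H)
      (i := idx1 ⟨0, hp⟩))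
  have e1 : ∀ y, S * A y = (A h)⁻¹ * X y * A h * S := fun y => by
    refine (inr_mul_inl _ _).trans ?_
    have := congrArg (SemidirectProduct.inl · * S) ((hρ ⟨0, hp⟩).1 y)
    simp only [map_mul, map_inv] at this
    exact this
  have e2 : ∀ y, S * X y = A h * A y * (A h)⁻¹ * S := fun y => by
    refine (inr_mul_inl _ _).trans ?_
    have := congrArg (SemidirectProduct.inl · * S) ((hρ ⟨0, hp⟩).2.1 y)
    simp only [map_mul, map_inv] at this
    exact this
  change A y * (S * A h * S) = S * A h * S * A (h⁻¹ * y * h)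
  calc A y * (S * A h * S) = A h * A (h⁻¹ * y * h) * (A h)⁻¹ * S * A h * S := by
        simp only [map_mul, map_inv]; group
    _ = S * A h * ((A h)⁻¹ * X (h⁻¹ * y * h) * A h * S) := by rw [← e2]; group
    _ = _ := by rw [← e1]; group

end relations

theorem asc_extendOne {P : Type*} [Monoid P] (a : P) {m : ℕ} (g : Fin m → P) :
    asc a (Fin.extendOne g) m = a * (List.ofFn g).prod := by
  have key : ∀ k (hk : k ≤ m), asc a (Fin.extendOne g) k =
      a * (List.ofFn fun i : Fin k => g (Fin.castLE hk i)).prod := by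
    intro k
    induction k with
    | zero => simp [asc]
    | succ k ih =>
      intro hk
      rw [asc, ih (by omega), List.ofFn_succ', List.concat_eq_append, List.prod_append,
        List.prod_singleton, mul_assoc]
      congr 2
      exact dif_pos hk
  exact key m le_rfl

theorem semidirect_product_garside (n : ℕ) (hn : 2 ≤ n)
    {H : Type} [Group H] (M : Submonoid H) (hGar : M)
    (hGarside : IsGarside M hGar)
    (hfrac : ∀ g : H, ∃ a b : M, g = (a : H)⁻¹ * (b : H))
    (ρ : BraidGroup (n - 1) →* MulAut (Monoid.CoprodI (fun _ : Fin n => H)))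
    (hρ : IsArtinRep ((hGar : H)) ρ) :
    ∃ hmem : tildeDelta n hn (hGar : H) ρ ∈ tildeM n hn M ρ,
      IsGarside (tildeM n hn M ρ) ⟨tildeDelta n hn (hGar : H) ρ, hmem⟩ := by
  obtain ⟨d⟩ := hGarside.nonempty_data
  have hN := d.isGarside hGarside (n - 1)
  have hτ : ∀ y : M, ((d.τ y : M) : H) = (hGar : H)⁻¹ * y * hGar := fun y => by
    rw [mul_assoc, eq_inv_mul_iff_mul_eq]
    exact congrArg Subtype.val (d.mul_h y).symm
  obtain ⟨F, _, j, hj⟩ : ∃ (F : Type) (_ : Group F) (j : d.N (n - 1) →* F),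
      Function.Injective j := by
    obtain ⟨-, -, hl, hr, -, -, -, -, hjoin, -, -, -⟩ := hN
    refine exists_injective_hom_group hl hr fun a b => ?_
    obtain ⟨_, ⟨x, rfl⟩, ⟨y, hy⟩, -⟩ := hjoin a b
    exact ⟨x, y, hy.symm⟩
  obtain ⟨f, hf⟩ := exists_extension_of_fractions hfrac (j.comp (d.ι (n - 1)))
  have B := d.braidRelations (n - 1)
  let σ : ℕ → F := fun k => j (Fin.extendOne d.s k)
  obtain ⟨ψ, hψ1, hψ2⟩ : ∃ ψ : Monoid.CoprodI (fun _ : Fin n => H) ⋊[ρ] BraidGroup (n - 1) →* F,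
      (∀ y, ψ (SemidirectProduct.inl (Monoid.CoprodI.of (i := (⟨0, by omega⟩ : Fin n)) y)) = f y) ∧
      ∀ i : Fin (n - 1), ψ (SemidirectProduct.inr (braidGen i)) = σ i := by
    refine exists_hom_semidirect (fun i k h1 h2 => (B.comm i k h1 h2).map j)
      (fun i hi => by simpa only [map_mul] using congrArg j (B.braid i hi)) (fun y i h0 hi => ?_)
      (fun y h0 => ?_) rfl hn hρ
    · obtain ⟨a, b, rfl⟩ := hfrac y
      rw [map_mul, map_inv, hf, hf]
      exact ((B.comm_f a i h0 hi).map j).inv_left.mul_left ((B.comm_f b i h0 hi).map j)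
    · have key := hom_ext_of_fractions hfrac
        (f := f) (g := ((MulAut.conj (σ 0 * f hGar * σ 0)).toMonoidHom.comp f).comp
          (MulAut.conj (hGar : H)⁻¹).toMonoidHom) fun y => by
            have h1 := congrArg j (B.f_mul y h0)
            simp only [map_mul] at h1
            change f y = σ 0 * f hGar * σ 0 * f ((hGar : H)⁻¹ * y * (hGar : H)⁻¹⁻¹) *
              (σ 0 * f hGar * σ 0)⁻¹
            rw [inv_inv, ← hτ, eq_mul_inv_iff_mul_eq, hf, hf, hf]
            exact h1
      have h1 := DFunLike.congr_fun key y
      change f y = σ 0 * f hGar * σ 0 * f ((hGar : H)⁻¹ * y * (hGar : H)⁻¹⁻¹) *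
        (σ 0 * f hGar * σ 0)⁻¹ at h1
      rwa [inv_inv, eq_mul_inv_iff_mul_eq] at h1
  let θ : d.N (n - 1) →* Monoid.CoprodI (fun _ : Fin n => H) ⋊[ρ] BraidGroup (n - 1) :=
    d.lift ((SemidirectProduct.inl.comp
        (Monoid.CoprodI.of (M := fun _ : Fin n => H) (i := ⟨0, by omega⟩))).comp M.subtype)
      (fun i => SemidirectProduct.inr (braidGen i))
      (fun i k hik => by rw [← map_mul, ← map_mul, braidGen_commute i k hik])
      (fun i k hik => by simp only [← map_mul, braidGen_braid i k hik])
      (fun y i hi => hρ.inl_mul_inr hn y i hi)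
      (fun y i hi => by
        have := hρ.inl_mul hn y i hi
        rw [← hτ] at this
        exact this)
  have hθs : ∀ i, θ (d.s i) = SemidirectProduct.inr (braidGen i) := fun i => d.lift_s ..
  have hθι : ∀ y, θ (d.ι (n - 1) y) = SemidirectProduct.inl
      (Monoid.CoprodI.of (M := fun _ : Fin n => H) (i := ⟨0, by omega⟩) (y : H)) :=
    fun y => d.lift_ι ..
  have hψθ : ψ.comp θ = j := d.hom_ext
    (fun y => by rw [MonoidHom.comp_apply, hθι, hψ1, hf]; rfl)
    (fun i => by
      rw [MonoidHom.comp_apply, hθs, hψ2]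
      exact congrArg j (Fin.extendOne_val d.s i))
  have hθ : Function.Injective θ := by
    refine Function.Injective.of_comp (f := ψ) ?_
    rw [← MonoidHom.coe_comp, hψθ]
    exact hj
  have hrange : MonoidHom.mrange θ = tildeM n hn M ρ := by
    rw [MonoidHom.mrange_eq_map, ← d.closure_eq_top, MonoidHom.map_mclosure, Set.image_union,
      ← Set.range_comp, ← Set.range_comp]
    rw [show ⇑θ ∘ d.ι (n - 1) = _ from funext hθι, show ⇑θ ∘ d.s = _ from funext hθs]
    rfl
  have hΔ : θ (d.Δ (n - 1)) = tildeDelta n hn (hGar : H) ρ := by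
    rw [GarsideData.Δ, ← B.asc_pow_eq_palProd le_rfl, asc_extendOne, map_pow, map_mul,
      map_list_prod, List.map_ofFn, hθι, tildeDelta, show ⇑θ ∘ d.s = _ from funext hθs,
      Nat.sub_add_cancel (by omega)]
  let e : d.N (n - 1) ≃* tildeM n hn M ρ :=
    (MulEquiv.ofBijective θ.mrangeRestrict
      ⟨fun x y hxy => hθ (congrArg Subtype.val hxy), θ.mrangeRestrict_surjective⟩).trans
      (MulEquiv.submonoidCongr hrange)
  have he : ∀ x, (e x : _ ⋊[ρ] _) = θ x := fun x => rfl
  have hmem : tildeDelta n hn (hGar : H) ρ ∈ tildeM n hn M ρ :=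
    hΔ ▸ he (d.Δ (n - 1)) ▸ (e (d.Δ (n - 1))).2
  refine ⟨hmem, ?_⟩
  have h1 : e (d.Δ (n - 1)) = ⟨tildeDelta n hn (hGar : H) ρ, hmem⟩ := Subtype.ext hΔ
  exact h1 ▸ hN.map e
end

section
/- Let n ≥ 2 and let k, l be non-zero integers. The Wada representations of type (1), ρ_k^{(1)} : Bₙ → Aut(Fₙ) and ρ_l^{(1)} : Bₙ → Aut(Fₙ), are equivalent if and only if l = k or l = −k. -/
/-- Wada's representation of type (1) with parameter `h`:
`σ_k ↦ (x_k ↦ x_k^{-h} x_{k+1} x_k^h, x_{k+1} ↦ x_k)`. -/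
def IsWada1 {n : ℕ} (h : ℤ) (ρ : BraidGroup (n - 1) →* MulAut (FreeGroup (Fin n))) : Prop :=
  ∀ k : Fin (n - 1),
    ρ (braidGen k) (FreeGroup.of (idx0 k)) =
      (FreeGroup.of (idx0 k)) ^ (-h) * FreeGroup.of (idx1 k) * (FreeGroup.of (idx0 k)) ^ h ∧
    ρ (braidGen k) (FreeGroup.of (idx1 k)) = FreeGroup.of (idx0 k) ∧
    ∀ j : Fin n, j ≠ idx0 k → j ≠ idx1 k → ρ (braidGen k) (FreeGroup.of j) = FreeGroup.of j

/-- Wada's representation of type (2):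
`σ_k ↦ (x_k ↦ x_k x_{k+1}⁻¹ x_k, x_{k+1} ↦ x_k)`. -/
def IsWada2 {n : ℕ} (ρ : BraidGroup (n - 1) →* MulAut (FreeGroup (Fin n))) : Prop :=
  ∀ k : Fin (n - 1),
    ρ (braidGen k) (FreeGroup.of (idx0 k)) =
      FreeGroup.of (idx0 k) * (FreeGroup.of (idx1 k))⁻¹ * FreeGroup.of (idx0 k) ∧
    ρ (braidGen k) (FreeGroup.of (idx1 k)) = FreeGroup.of (idx0 k) ∧
    ∀ j : Fin n, j ≠ idx0 k → j ≠ idx1 k → ρ (braidGen k) (FreeGroup.of j) = FreeGroup.of j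

/-- Wada's representation of type (3):
`σ_k ↦ (x_k ↦ x_k² x_{k+1}, x_{k+1} ↦ x_{k+1}⁻¹ x_k⁻¹ x_{k+1})`. -/
def IsWada3 {n : ℕ} (ρ : BraidGroup (n - 1) →* MulAut (FreeGroup (Fin n))) : Prop :=
  ∀ k : Fin (n - 1),
    ρ (braidGen k) (FreeGroup.of (idx0 k)) =
      FreeGroup.of (idx0 k) ^ 2 * FreeGroup.of (idx1 k) ∧
    ρ (braidGen k) (FreeGroup.of (idx1 k)) =
      (FreeGroup.of (idx1 k))⁻¹ * (FreeGroup.of (idx0 k))⁻¹ * FreeGroup.of (idx1 k) ∧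
    ∀ j : Fin n, j ≠ idx0 k → j ≠ idx1 k → ρ (braidGen k) (FreeGroup.of j) = FreeGroup.of j

/-- Two representations `ρ, ρ' : B → Aut G` are equivalent if there are automorphisms
`φ : G → G` and `μ : B → B` with `ρ'(μ(β)) = φ⁻¹ ∘ ρ(β) ∘ φ` for all `β`. -/
def EquivReps {B G : Type*} [Group B] [Group G] (ρ ρ' : B →* MulAut G) : Prop :=
  ∃ (φ : G ≃* G) (μ : B ≃* B), ∀ (β : B) (g : G), ρ' (μ β) g = φ.symm (ρ β (φ g))

/-- The Heisenberg group of unitriangular `3 × 3` matrices over `R`, in coordinates. -/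
@[ext]
structure Heis (R : Type) where
  a : R
  b : R
  c : R

namespace Heis

variable {R : Type} [CommRing R]

instance : Mul (Heis R) := ⟨fun x y => ⟨x.a + y.a, x.b + y.b, x.c + y.c + x.a * y.b⟩⟩
instance : One (Heis R) := ⟨⟨0, 0, 0⟩⟩
instance : Inv (Heis R) := ⟨fun x => ⟨-x.a, -x.b, -x.c + x.a * x.b⟩⟩

@[simp] lemma mul_a (x y : Heis R) : (x * y).a = x.a + y.a := rfl
@[simp] lemma mul_b (x y : Heis R) : (x * y).b = x.b + y.b := rfl
@[simp] lemma mul_c (x y : Heis R) : (x * y).c = x.c + y.c + x.a * y.b := rfl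
@[simp] lemma one_a : (1 : Heis R).a = 0 := rfl
@[simp] lemma one_b : (1 : Heis R).b = 0 := rfl
@[simp] lemma one_c : (1 : Heis R).c = 0 := rfl
@[simp] lemma inv_a (x : Heis R) : x⁻¹.a = -x.a := rfl
@[simp] lemma inv_b (x : Heis R) : x⁻¹.b = -x.b := rfl
@[simp] lemma inv_c (x : Heis R) : x⁻¹.c = -x.c + x.a * x.b := rfl

instance : Group (Heis R) :=
  Group.ofLeftAxioms
    (fun x y z => by ext <;> simp <;> ring)
    (fun x => by ext <;> simp)
    (fun x => by ext <;> simp)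

/-- The projection to the first coordinate. -/
def aHom : Heis R →* Multiplicative R where
  toFun x := Multiplicative.ofAdd x.a
  map_one' := rfl
  map_mul' _ _ := rfl

/-- The projection to the second coordinate. -/
def bHom : Heis R →* Multiplicative R where
  toFun x := Multiplicative.ofAdd x.b
  map_one' := rfl
  map_mul' _ _ := rfl

lemma zpow_a (x : Heis R) (m : ℤ) : (x ^ m).a = m * x.a := by
  have h := congrArg Multiplicative.toAdd (map_zpow aHom x m)
  rw [toAdd_zpow, zsmul_eq_mul] at h
  exact h

lemma zpow_b (x : Heis R) (m : ℤ) : (x ^ m).b = m * x.b := by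
  have h := congrArg Multiplicative.toAdd (map_zpow bHom x m)
  rw [toAdd_zpow, zsmul_eq_mul] at h
  exact h

lemma commute_iff (x y : Heis R) : Commute x y ↔ x.a * y.b = y.a * x.b := by
  constructor
  · intro h
    have h' := congrArg Heis.c h.eq
    simp only [mul_c] at h'
    linear_combination h'
  · intro h
    ext
    · simp [add_comm]
    · simp [add_comm]
    · simp only [mul_c]
      linear_combination h

lemma commute_zpow_of_cast_eq_zero {m : ℤ} (hm : (m : R) = 0) (x y : Heis R) :
    Commute (x ^ m) y := by
  simp [commute_iff, zpow_a, zpow_b, hm]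

end Heis

/-- Every `β` acting trivially on homomorphisms to `ℤ` acts trivially on homomorphisms to `H`. -/
def TrivialOnHoms {B G : Type*} [Group B] [Group G] (H : Type) [Group H] (ρ : B →* MulAut G) :
    Prop :=
  ∀ β : B, (∀ (f : G →* Multiplicative ℤ) (x : G), f (ρ β x) = f x) →
    ∀ (f : G →* H) (x : G), f (ρ β x) = f x

lemma EquivReps.symm {B G : Type*} [Group B] [Group G] {ρ ρ' : B →* MulAut G}
    (h : EquivReps ρ ρ') : EquivReps ρ' ρ := by
  obtain ⟨φ, μ, h⟩ := h
  refine ⟨φ.symm, μ.symm, fun β g => ?_⟩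
  have := h (μ.symm β) (φ.symm g)
  simp only [MulEquiv.apply_symm_apply] at this
  simp [this]

lemma TrivialOnHoms.of_equivReps {B G : Type*} [Group B] [Group G] {H : Type} [Group H]
    {ρ ρ' : B →* MulAut G} (hρ : TrivialOnHoms H ρ) (h : EquivReps ρ ρ') :
    TrivialOnHoms H ρ' := by
  obtain ⟨φ, μ, h⟩ := h
  intro β hβ f x
  have key : ∀ g, ρ' β g = φ.symm (ρ (μ.symm β) (φ g)) := fun g => by
    rw [← h, MulEquiv.apply_symm_apply]
  have hf := hρ (μ.symm β) (fun f' y => by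
    have := hβ (f'.comp φ.toMonoidHom) (φ.symm y)
    simpa [key] using this) (f.comp φ.symm.toMonoidHom) (φ x)
  simpa [key] using hf

lemma idx0_ne_idx1 {n : ℕ} (i : Fin (n - 1)) : idx0 i ≠ idx1 i := by
  simp [idx0, idx1]

lemma closure_braidGen (m : ℕ) :
    Subgroup.closure (Set.range (braidGen : Fin m → BraidGroup m)) = ⊤ :=
  PresentedGroup.closure_range_of _

/-- In a group where `k`-th powers are central, `ρ_k` acts by permuting the free generators. -/
lemma IsWada1.exists_perm {n : ℕ} {k : ℤ} {ρ : BraidGroup (n - 1) →* MulAut (FreeGroup (Fin n))}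
    (hρ : IsWada1 k ρ) (β : BraidGroup (n - 1)) :
    ∃ π : Equiv.Perm (Fin n), ∀ (H : Type) [Group H], (∀ x y : H, Commute (x ^ k) y) →
      ∀ (f : FreeGroup (Fin n) →* H) (j : Fin n),
        f (ρ β (FreeGroup.of j)) = f (FreeGroup.of (π j)) := by
  have hβ : β ∈ Subgroup.closure (Set.range (braidGen : Fin (n - 1) → BraidGroup (n - 1))) := by
    rw [closure_braidGen]; trivial
  induction hβ using Subgroup.closure_induction with
  | mem x hx =>
    obtain ⟨i, rfl⟩ := hx
    obtain ⟨h0, h1, h2⟩ := hρ i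
    refine ⟨Equiv.swap (idx0 i) (idx1 i), fun H _ hH f j => ?_⟩
    by_cases hj0 : j = idx0 i
    · subst hj0
      rw [h0, Equiv.swap_apply_left]
      simp only [map_mul, map_inv, map_zpow, zpow_neg]
      rw [mul_assoc, ← (hH (f (FreeGroup.of (idx0 i))) (f (FreeGroup.of (idx1 i)))).eq,
        inv_mul_cancel_left]
    · by_cases hj1 : j = idx1 i
      · subst hj1
        rw [h1, Equiv.swap_apply_right]
      · rw [h2 j hj0 hj1, Equiv.swap_apply_of_ne_of_ne hj0 hj1]
  | one => exact ⟨1, fun H _ _ f j => by simp⟩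
  | mul x y _ _ ihx ihy =>
    obtain ⟨π, hπ⟩ := ihx
    obtain ⟨τ, hτ⟩ := ihy
    refine ⟨π * τ, fun H _ hH f j => ?_⟩
    have h := hτ H hH (f.comp (ρ x).toMonoidHom) j
    simp only [MonoidHom.comp_apply, MulEquiv.toMonoidHom_eq_coe, MonoidHom.coe_coe] at h
    rw [map_mul, MulAut.mul_apply, h, hπ H hH f, Equiv.Perm.mul_apply]
  | inv x _ ih =>
    obtain ⟨π, hπ⟩ := ih
    refine ⟨π.symm, fun H _ hH f j => ?_⟩
    have h := hπ H hH (f.comp (ρ x)⁻¹.toMonoidHom) (π.symm j)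
    simp only [MonoidHom.comp_apply, MulEquiv.toMonoidHom_eq_coe, MonoidHom.coe_coe,
      MulAut.inv_apply_self, Equiv.apply_symm_apply] at h
    rw [map_inv, ← h]

lemma IsWada1.trivialOnHoms {n : ℕ} {k : ℤ}
    {ρ : BraidGroup (n - 1) →* MulAut (FreeGroup (Fin n))} (hρ : IsWada1 k ρ) {H : Type} [Group H]
    (hH : ∀ x y : H, Commute (x ^ k) y) : TrivialOnHoms H ρ := by
  intro β hβ f x
  obtain ⟨π, hπ⟩ := hρ.exists_perm β
  have hid : ∀ j, π j = j := fun j => by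
    let g : FreeGroup (Fin n) →* Multiplicative ℤ :=
      FreeGroup.lift fun i => Multiplicative.ofAdd (if i = j then 1 else 0)
    have h := (hπ _ (fun x y => Commute.all _ _) g j).symm.trans (hβ g (FreeGroup.of j))
    by_contra hne
    simp only [g, FreeGroup.lift_apply_of, if_neg hne, if_true] at h
    exact zero_ne_one (α := ℤ) (congrArg Multiplicative.toAdd h)
  have hext : f.comp (ρ β).toMonoidHom = f := by
    ext j
    simpa [hid] using hπ H hH f j
  exact DFunLike.congr_fun hext x

lemma IsWada1.commute_of_trivialOnHoms {n : ℕ} (hn : 2 ≤ n) {l : ℤ}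
    {ρ : BraidGroup (n - 1) →* MulAut (FreeGroup (Fin n))} (hρ : IsWada1 l ρ) {H : Type} [Group H]
    (hH : TrivialOnHoms H ρ) (x y : H) : Commute (x ^ l) y := by
  let i : Fin (n - 1) := ⟨0, by omega⟩
  obtain ⟨h0, h1, h2⟩ := hρ i
  have hsq : ∀ (f : FreeGroup (Fin n) →* Multiplicative ℤ) (w : FreeGroup (Fin n)),
      f (ρ (braidGen i * braidGen i) w) = f w := by
    intro f w
    have hext : f.comp (ρ (braidGen i * braidGen i)).toMonoidHom = f := by
      ext j
      by_cases hj0 : j = idx0 i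
      · subst hj0
        simp [h0, h1]
      · by_cases hj1 : j = idx1 i
        · subst hj1
          simp [h0, h1]
        · simp [h2 j hj0 hj1]
    exact DFunLike.congr_fun hext w
  let f : FreeGroup (Fin n) →* H := FreeGroup.lift fun j => if j = idx0 i then x else y
  have h := hH _ hsq f (FreeGroup.of (idx1 i))
  have hne := (idx0_ne_idx1 i).symm
  simp only [map_mul, MulAut.mul_apply, h1, h0, map_inv, map_zpow, f, FreeGroup.lift_apply_of, if_true,
    if_neg hne, zpow_neg] at h
  rw [mul_assoc, inv_mul_eq_iff_eq_mul] at h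
  exact h.symm

lemma IsWada1.natAbs_dvd_of_equivReps {n : ℕ} (hn : 2 ≤ n) {k l : ℤ}
    {ρk ρl : BraidGroup (n - 1) →* MulAut (FreeGroup (Fin n))}
    (hρk : IsWada1 k ρk) (hρl : IsWada1 l ρl) (h : EquivReps ρk ρl) : k.natAbs ∣ l.natAbs := by
  have hk : ((k : ℤ) : ZMod k.natAbs) = 0 := by
    rw [ZMod.intCast_zmod_eq_zero_iff_dvd]
    exact Int.natAbs_dvd.mpr dvd_rfl
  have htriv := (hρk.trivialOnHoms
    (Heis.commute_zpow_of_cast_eq_zero (R := ZMod k.natAbs) hk)).of_equivReps h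
  have hc := hρl.commute_of_trivialOnHoms hn htriv ⟨1, 0, 0⟩ ⟨0, 1, 0⟩
  rw [Heis.commute_iff, Heis.zpow_a] at hc
  simp only [mul_one, zero_mul] at hc
  rw [ZMod.intCast_zmod_eq_zero_iff_dvd] at hc
  exact Int.natCast_dvd.mp hc

/-- Inversion of the free generators. -/
def freeGroupInvGenerators (α : Type*) : FreeGroup α ≃* FreeGroup α :=
  MonoidHom.toMulEquiv (FreeGroup.lift fun i => (FreeGroup.of i)⁻¹)
    (FreeGroup.lift fun i => (FreeGroup.of i)⁻¹) (by ext; simp) (by ext; simp)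

lemma freeGroupInvGenerators_of {α : Type*} (i : α) :
    freeGroupInvGenerators α (FreeGroup.of i) = (FreeGroup.of i)⁻¹ := by
  simp [freeGroupInvGenerators]

lemma freeGroupInvGenerators_symm_of {α : Type*} (i : α) :
    (freeGroupInvGenerators α).symm (FreeGroup.of i) = (FreeGroup.of i)⁻¹ := by
  rw [MulEquiv.symm_apply_eq, map_inv, freeGroupInvGenerators_of, inv_inv]

lemma IsWada1.unique {n : ℕ} {k : ℤ} {ρ ρ' : BraidGroup (n - 1) →* MulAut (FreeGroup (Fin n))}
    (hρ : IsWada1 k ρ) (hρ' : IsWada1 k ρ') : ρ = ρ' := by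
  refine PresentedGroup.ext fun i => ?_
  obtain ⟨h0, h1, h2⟩ := hρ i
  obtain ⟨h0', h1', h2'⟩ := hρ' i
  apply MulEquiv.toMonoidHom_injective
  ext j
  change ρ (braidGen i) (FreeGroup.of j) = ρ' (braidGen i) (FreeGroup.of j)
  by_cases hj0 : j = idx0 i
  · rw [hj0, h0, h0']
  · by_cases hj1 : j = idx1 i
    · rw [hj1, h1, h1']
    · rw [h2 j hj0 hj1, h2' j hj0 hj1]

lemma IsWada1.conj_invGenerators {n : ℕ} {k : ℤ}
    {ρ : BraidGroup (n - 1) →* MulAut (FreeGroup (Fin n))} (hρ : IsWada1 k ρ) :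
    IsWada1 (-k) ((MulAut.conj (freeGroupInvGenerators (Fin n))⁻¹).toMonoidHom.comp ρ) := by
  intro i
  obtain ⟨h0, h1, h2⟩ := hρ i
  have key : ∀ w, ((MulAut.conj (freeGroupInvGenerators (Fin n))⁻¹).toMonoidHom.comp ρ)
      (braidGen i) w = (freeGroupInvGenerators (Fin n)).symm
        (ρ (braidGen i) (freeGroupInvGenerators (Fin n) w)) := fun w => by
    simp [MulAut.inv_def]
  refine ⟨?_, ?_, fun j hj0 hj1 => ?_⟩
  · rw [key, freeGroupInvGenerators_of]
    simp only [map_inv, h0, map_mul, map_zpow, freeGroupInvGenerators_symm_of]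
    simp [mul_assoc]
  · rw [key, freeGroupInvGenerators_of, map_inv, h1, map_inv, freeGroupInvGenerators_symm_of,
      inv_inv]
  · rw [key, freeGroupInvGenerators_of, map_inv, h2 j hj0 hj1, map_inv,
      freeGroupInvGenerators_symm_of, inv_inv]

theorem wada1_equiv_iff (n : ℕ) (hn : 2 ≤ n) (k l : ℤ) (hk : k ≠ 0) (hl : l ≠ 0)
    (ρk ρl : BraidGroup (n - 1) →* MulAut (FreeGroup (Fin n)))
    (hρk : IsWada1 k ρk) (hρl : IsWada1 l ρl) :
    EquivReps ρk ρl ↔ (l = k ∨ l = -k) := by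
  constructor
  · intro h
    exact Int.natAbs_eq_natAbs_iff.mp (Nat.dvd_antisymm
      (hρl.natAbs_dvd_of_equivReps hn hρk h.symm) (hρk.natAbs_dvd_of_equivReps hn hρl h))
  · rintro (rfl | rfl)
    · exact ⟨MulEquiv.refl _, MulEquiv.refl _, fun β g => by rw [hρk.unique hρl]; rfl⟩
    · refine ⟨freeGroupInvGenerators (Fin n), MulEquiv.refl _, fun β g => ?_⟩
      rw [hρl.unique hρk.conj_invGenerators]
      simp [MulAut.inv_def]
end

section
/- Let n ≥ 2, let h be a non-zero integer, and consider the action of Bₙ on the free group Fₙ via the Wada representation ρ_h^{(1)}. Then for every i ∈ {1, …, n−1}, the subgroup of elements of Fₙ fixed by ρ_h^{(1)}(σᵢ) equals the subgroup generated by x₁, …, x_{i−1}, x_{i+1}^{h} x_i^{h}, x_{i+2}, …, xₙ. -/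
namespace FreeGroup

variable {α : Type*}

/-- Commuting elements of a free group are powers of a common element. -/
theorem exists_mem_zpowers_of_commute {u v : FreeGroup α} (huv : Commute u v) :
    ∃ d : FreeGroup α, u ∈ Subgroup.zpowers d ∧ v ∈ Subgroup.zpowers d := by
  classical
  let H := Subgroup.closure ({u, v} : Set (FreeGroup α))
  have hcomm : ∀ x y : H, x * y = y * x := by
    have : IsMulCommutative H := by
      apply Subgroup.isMulCommutative_closure
      rintro x (rfl | rfl) y (rfl | rfl)
      exacts [rfl, huv, huv.symm, rfl]
    exact fun x y => mul_comm' x y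
  let e := IsFreeGroup.toFreeGroup H
  have hsub : Subsingleton (IsFreeGroup.Generators H) := by
    refine ⟨fun x y => ?_⟩
    by_contra hxy
    have h1 : of x * of y = of y * of x := by
      simpa using congrArg e (hcomm (e.symm (of x)) (e.symm (of y)))
    have h2 := congrArg toWord h1
    simp [toWord_mul, reduce, hxy, Ne.symm hxy] at h2
  have hcyc : IsCyclic (FreeGroup (IsFreeGroup.Generators H)) := by
    rcases isEmpty_or_nonempty (IsFreeGroup.Generators H) with _ | ⟨⟨x⟩⟩
    · infer_instance
    · have : Unique (IsFreeGroup.Generators H) := ⟨⟨x⟩, fun y => Subsingleton.elim _ _⟩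
      infer_instance
  have : IsCyclic H := isCyclic_of_injective e.toMonoidHom e.injective
  obtain ⟨d, hd⟩ := IsCyclic.exists_generator (α := H)
  have key : ∀ x ∈ H, x ∈ Subgroup.zpowers (d : FreeGroup α) := by
    intro x hx
    obtain ⟨k, hk⟩ := Subgroup.mem_zpowers_iff.1 (hd ⟨x, hx⟩)
    exact Subgroup.mem_zpowers_iff.2 ⟨k, by simpa using congrArg Subtype.val hk⟩
  exact ⟨d, key u (Subgroup.subset_closure (by simp)), key v (Subgroup.subset_closure (by simp))⟩

theorem toWord_of_pow_mul_of_pow [DecidableEq α] (a b : α) (k l : ℕ) :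
    (of b ^ k * of a ^ l).toWord = List.replicate k (b, true) ++ List.replicate l (a, true) := by
  rw [toWord_mul, toWord_of_pow, toWord_of_pow]
  apply IsReduced.reduce_eq
  refine List.Pairwise.isChain (List.pairwise_of_forall_mem_list fun x hx y hy _ => ?_)
  simp only [List.mem_append, List.mem_replicate] at hx hy
  grind

/-- For distinct generators `a` and `b`, the element `b ^ k * a ^ k` is not a proper power. -/
theorem eq_one_of_of_pow_mul_of_pow_eq_pow {a b : α} (hab : a ≠ b) {k : ℕ} (hk : k ≠ 0)
    {d : FreeGroup α} {m : ℕ} (h : of b ^ k * of a ^ k = d ^ m) : m = 1 := by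
  classical
  have hw := congrArg toWord h
  rw [toWord_of_pow_mul_of_pow, toWord_pow,
    reduceCyclically.reduce_flatten_replicate isReduced_toWord] at hw
  match m with
  | 0 => simp [hk] at hw
  | 1 => rfl
  | m + 2 =>
    set C := reduceCyclically.conjugator d.toWord
    set R := reduceCyclically d.toWord
    rw [if_neg (by omega)] at hw
    have hpos : ∀ x ∈ C ++ (List.replicate (m + 2) R).flatten ++ invRev C, x.2 = true := by
      rw [← hw]
      intro x hx
      simp only [List.mem_append, List.mem_replicate] at hx
      rcases hx with ⟨-, rfl⟩ | ⟨-, rfl⟩ <;> rfl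
    have hC : C = [] := by
      refine List.eq_nil_iff_forall_not_mem.2 fun x hx => ?_
      have h1 := hpos x (by simp [hx])
      have h2 := hpos (x.1, !x.2) (by
        simp only [List.mem_append]
        right
        simp only [invRev, List.mem_reverse, List.mem_map]
        exact ⟨x, hx, rfl⟩)
      simp [h1] at h2
    simp only [hC, invRev_empty, List.nil_append, List.append_nil] at hw
    have hmem : ∀ x ∈ List.replicate k (b, true) ++ List.replicate k (a, true), x ∈ R := by
      rw [hw]
      simp
    have ha : (a, true) ∈ R := hmem _ (by simp [hk])
    have hb : (b, true) ∈ R := hmem _ (by simp [hk])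
    have hp : (List.replicate k (b, true) ++ List.replicate k (a, true)).Pairwise
        fun x y => ¬(x.1 = a ∧ y.1 = b) := by
      simp [List.pairwise_append, List.pairwise_replicate, List.mem_replicate, hab, Ne.symm hab]
    rw [hw, List.replicate_succ, List.replicate_succ, List.flatten_cons, List.flatten_cons,
      List.pairwise_append] at hp
    exact (hp.2.2 (a, true) ha (b, true) (by simp [hb]) ⟨rfl, rfl⟩).elim

theorem mem_zpowers_of_commute_of_pow_mul_of_pow {a b : α} (hab : a ≠ b) {k : ℕ} (hk : k ≠ 0)
    {u : FreeGroup α} (hu : Commute u (of b ^ k * of a ^ k)) :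
    u ∈ Subgroup.zpowers (of b ^ k * of a ^ k) := by
  obtain ⟨d, hud, hcd⟩ := exists_mem_zpowers_of_commute hu
  obtain ⟨m, hm⟩ := Subgroup.mem_zpowers_iff.1 hcd
  rw [← hm]
  obtain ⟨m, rfl | rfl⟩ := m.eq_nat_or_neg
  · rw [zpow_natCast] at hm
    simpa [eq_one_of_of_pow_mul_of_pow_eq_pow hab hk hm.symm] using hud
  · rw [zpow_neg, zpow_natCast, ← inv_pow] at hm
    simpa [eq_one_of_of_pow_mul_of_pow_eq_pow hab hk hm.symm] using hud

/-- For distinct generators `a` and `b` and `h ≠ 0`, the centralizer of `b ^ h * a ^ h` is the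
cyclic group it generates. -/
theorem mem_zpowers_of_commute_of_zpow_mul_of_zpow {a b : α} (hab : a ≠ b) {h : ℤ} (hh : h ≠ 0)
    {u : FreeGroup α} (hu : Commute u (of b ^ h * of a ^ h)) :
    u ∈ Subgroup.zpowers (of b ^ h * of a ^ h) := by
  obtain ⟨k, rfl | rfl⟩ := h.eq_nat_or_neg
  · simp only [zpow_natCast] at hu ⊢
    exact mem_zpowers_of_commute_of_pow_mul_of_pow hab (by simpa using hh) hu
  · have hinv : of b ^ (-(k : ℤ)) * of a ^ (-(k : ℤ)) = (of a ^ k * of b ^ k)⁻¹ := by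
      simp [mul_inv_rev]
    rw [hinv] at hu ⊢
    rw [Subgroup.zpowers_inv]
    exact mem_zpowers_of_commute_of_pow_mul_of_pow hab.symm (by simpa using hh)
      (Commute.inv_right_iff.1 hu)

end FreeGroup

/-- An element of a free product fixed by a free product of injective endomorphisms is a product
of fixed elements of the factors. -/
theorem Monoid.CoprodI.mem_of_lift_of_comp_eq_self {ι : Type*} {M : ι → Type*}
    [∀ i, Monoid (M i)] (f : ∀ i, M i →* M i) (hf : ∀ i, Function.Injective (f i))
    {w : Monoid.CoprodI M}
    (hw : Monoid.CoprodI.lift (fun i => (Monoid.CoprodI.of (i := i)).comp (f i)) w = w)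
    (S : Submonoid (Monoid.CoprodI M))
    (hS : ∀ i (m : M i), f i m = m → Monoid.CoprodI.of m ∈ S) : w ∈ S := by
  classical
  obtain ⟨v, rfl⟩ := Monoid.CoprodI.Word.equiv.symm.surjective w
  change Monoid.CoprodI.lift _ v.prod = v.prod at hw
  change v.prod ∈ S
  let v' : Monoid.CoprodI.Word M :=
    { toList := v.toList.map fun l => ⟨l.1, f l.1 l.2⟩
      ne_one := by
        intro l hl
        obtain ⟨l', hl', rfl⟩ := List.mem_map.1 hl
        exact (map_ne_one_iff _ (hf _)).2 (v.ne_one l' hl')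
      chain_ne := by
        rw [List.isChain_map]
        exact v.chain_ne }
  have hv' : v'.prod = v.prod := by
    rw [← hw]
    simp [Monoid.CoprodI.Word.prod, v', map_list_prod, Function.comp_def]
  have hlist : v.toList.map (fun l => (⟨l.1, f l.1 l.2⟩ : Σ i, M i)) = v.toList :=
    congrArg Monoid.CoprodI.Word.toList (Monoid.CoprodI.Word.equiv.symm.injective hv')
  have hfix : ∀ l ∈ v.toList, (⟨l.1, f l.1 l.2⟩ : Σ i, M i) = l :=
    List.map_inj_left.1 (hlist.trans (List.map_id _).symm)
  refine S.list_prod_mem fun x hx => ?_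
  obtain ⟨l, hl, rfl⟩ := List.mem_map.1 hx
  exact hS _ _ (eq_of_heq (Sigma.ext_iff.1 (hfix l hl)).2)

/-- An element fixed by the automorphism conjugating the generators `a` and `b` by
`b ^ h * a ^ h` and fixing the others is a product of powers of `b ^ h * a ^ h` and of the other
generators. -/
theorem FreeGroup.mem_closure_of_partial_conj_eq_self {α : Type*} {a b : α} (hab : a ≠ b)
    {h : ℤ} (hh : h ≠ 0) (ψ : FreeGroup α →* FreeGroup α)
    (hψa : ψ (of a) = (of b ^ h * of a ^ h)⁻¹ * of a * (of b ^ h * of a ^ h))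
    (hψb : ψ (of b) = (of b ^ h * of a ^ h)⁻¹ * of b * (of b ^ h * of a ^ h))
    (hψ : ∀ j, j ≠ a → j ≠ b → ψ (of j) = of j) {u : FreeGroup α} (hu : ψ u = u) :
    u ∈ Subgroup.closure ({x | ∃ j, j ≠ a ∧ j ≠ b ∧ x = of j} ∪ {of b ^ h * of a ^ h}) := by
  classical
  set T := Subgroup.closure ({x | ∃ j, j ≠ a ∧ j ≠ b ∧ x = of j} ∪ {of b ^ h * of a ^ h})
  let p : α → Bool := fun j => decide (j = a ∨ j = b)
  have hpa : p a = true := by simp [p]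
  have hpb : p b = true := by simp [p]
  let G : Bool → Type _ := fun t => FreeGroup {j // p j = t}
  let c : G true := of ⟨b, hpb⟩ ^ h * of ⟨a, hpa⟩ ^ h
  let g : ∀ t, G t := fun t => match t with
    | true => c⁻¹
    | false => 1
  let f : ∀ t, G t →* G t := fun t => (MulAut.conj (g t)).toMonoidHom
  let Θ : FreeGroup α →* Monoid.CoprodI G :=
    FreeGroup.lift fun j => Monoid.CoprodI.of (i := p j) (FreeGroup.of ⟨j, rfl⟩)
  let Λ : Monoid.CoprodI G →* FreeGroup α :=
    Monoid.CoprodI.lift fun t => FreeGroup.map (Subtype.val : {j // p j = t} → α)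
  have hΘ : ∀ (t : Bool) (j : α) (hj : p j = t),
      Θ (of j) = Monoid.CoprodI.of (M := G) (i := t) (FreeGroup.of ⟨j, hj⟩) := by
    rintro t j rfl
    simp [Θ]
  have hΛΘ : ∀ x, Λ (Θ x) = x := by
    have : Λ.comp Θ = MonoidHom.id _ := by
      ext j
      simp [Λ, Θ, G]
    exact DFunLike.congr_fun this
  let F := Monoid.CoprodI.lift fun t => (Monoid.CoprodI.of (M := G) (i := t)).comp (f t)
  have hΘc : Θ (of b ^ h * of a ^ h) = Monoid.CoprodI.of (M := G) (i := true) c := by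
    simp [hΘ true a hpa, hΘ true b hpb, c]
  have hF : F.comp Θ = Θ.comp ψ := by
    ext j
    simp only [MonoidHom.comp_apply]
    by_cases hj : j = a ∨ j = b
    · have hpj : p j = true := by simpa [p] using hj
      have hψj : ψ (of j) = (of b ^ h * of a ^ h)⁻¹ * of j * (of b ^ h * of a ^ h) := by
        rcases hj with rfl | rfl <;> assumption
      rw [hψj, Θ.map_mul, Θ.map_mul, Θ.map_inv, hΘc, hΘ true j hpj]
      simp [F, f, g]
    · have hpj : p j = false := by simpa [p] using hj
      push Not at hj
      rw [hψ j hj.1 hj.2, hΘ false j hpj]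
      simp [F, f, g]
  have hfix : F (Θ u) = Θ u := by
    rw [← MonoidHom.comp_apply, hF, MonoidHom.comp_apply, hu]
  rw [← hΛΘ u]
  refine Monoid.CoprodI.mem_of_lift_of_comp_eq_self f (fun t => (MulAut.conj (g t)).injective)
    hfix (T.comap Λ).toSubmonoid fun t m hm => ?_
  change Λ (Monoid.CoprodI.of m) ∈ T
  rw [Monoid.CoprodI.lift_of]
  cases t with
  | true =>
    have hcm : Commute m c := by
      have h1 : c⁻¹ * m * c⁻¹⁻¹ = m := hm
      rw [inv_inv, mul_assoc, inv_mul_eq_iff_eq_mul] at h1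
      exact h1
    obtain ⟨k, rfl⟩ := Subgroup.mem_zpowers_iff.1
      (mem_zpowers_of_commute_of_zpow_mul_of_zpow (by simpa using hab) hh hcm)
    rw [map_zpow]
    refine T.zpow_mem (Subgroup.subset_closure (Or.inr ?_)) k
    rw [Set.mem_singleton_iff, _root_.map_mul, map_zpow, map_zpow, FreeGroup.map.of, FreeGroup.map.of]
  | false =>
    have hle : (FreeGroup.map (Subtype.val : {j // p j = false} → α)).range ≤ T := by
      rw [FreeGroup.map_eq_lift, FreeGroup.range_lift_eq_closure, Subgroup.closure_le]
      rintro _ ⟨⟨j, hj⟩, rfl⟩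
      have hj' : j ≠ a ∧ j ≠ b := by simpa [p] using hj
      exact Subgroup.subset_closure (Or.inl ⟨j, hj'.1, hj'.2, rfl⟩)
    exact hle ⟨m, rfl⟩

theorem wada1_fixed_subgroup_sigma (n : ℕ) (hn : 2 ≤ n) (h : ℤ) (hh : h ≠ 0)
    (ρ : BraidGroup (n - 1) →* MulAut (FreeGroup (Fin n))) (hρ : IsWada1 h ρ)
    (i : Fin (n - 1)) :
    {u : FreeGroup (Fin n) | ρ (braidGen i) u = u} =
      (Subgroup.closure
        ({x : FreeGroup (Fin n) | ∃ j : Fin n, j ≠ idx0 i ∧ j ≠ idx1 i ∧ x = FreeGroup.of j} ∪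
          {(FreeGroup.of (idx1 i)) ^ h * (FreeGroup.of (idx0 i)) ^ h}) :
        Subgroup (FreeGroup (Fin n))) := by
  obtain ⟨ha, hb, hj⟩ := hρ i
  have hne : idx0 i ≠ idx1 i := by simp [idx0, idx1]
  have hpow (k : ℤ) : ρ (braidGen i) (FreeGroup.of (idx0 i)) ^ k =
      FreeGroup.of (idx0 i) ^ (-h) * FreeGroup.of (idx1 i) ^ k * FreeGroup.of (idx0 i) ^ h := by
    rw [ha]
    simpa using conj_zpow (i := k) (a := FreeGroup.of (idx0 i) ^ (-h))
      (b := FreeGroup.of (idx1 i))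
  ext u
  simp only [Set.mem_ofPred_eq, SetLike.mem_coe]
  constructor
  · intro hu
    refine FreeGroup.mem_closure_of_partial_conj_eq_self hne hh
      ((ρ (braidGen i)).toMonoidHom.comp (ρ (braidGen i)).toMonoidHom) ?_ ?_ ?_ ?_
    · change ρ (braidGen i) (ρ (braidGen i) _) = _
      rw [ha, map_mul, map_mul, map_zpow, map_zpow, hpow, hpow, hb]
      group
    · change ρ (braidGen i) (ρ (braidGen i) _) = _
      rw [hb, ha]
      group
    · intro j h0 h1
      simp [hj j h0 h1]
    · simp [hu]
  · intro hu
    suffices hle : _ ≤ (ρ (braidGen i)).toMonoidHom.eqLocus (MonoidHom.id (FreeGroup (Fin n)))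
      from hle hu
    rw [Subgroup.closure_le]
    rintro x (⟨j, h0, h1, rfl⟩ | rfl)
    · exact hj j h0 h1
    · change ρ (braidGen i) _ = FreeGroup.of (idx1 i) ^ h * FreeGroup.of (idx0 i) ^ h
      rw [map_mul, map_zpow, map_zpow, hpow, hb]
      group
end
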